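/- arXiv:2511.10511 — 3 statements merged into one kernel-verified Lean document; each statement's English description precedes it below -/
import Mathlib

section
/- For every k ≥ 1, the superalgebras G_{2k}^{gr} and G_{2k+1}^{gr} satisfy C^gr(G_{2k}^{gr}) = C^gr(G_{2k+1}^{gr}), although Id^gr(G_{2k}^{gr}) ≠ Id^gr(G_{2k+1}^{gr}). -/
noncomputable section

/-- The free superalgebra `F⟨Y,Z⟩`: the free unital associative `F`-algebra on the
even variables `Sum.inl i` (representing `y_{i+1}`) and the odd variables
`Sum.inr j` (representing `z_{j+1}`). -/
abbrev FA (F : Type) [Field F] : Type := FreeAlgebra F (ℕ ⊕ ℕ)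

variable (F : Type) [Field F]

/-- the even variable `y_{i+1}` -/
def yv (i : ℕ) : FA F := FreeAlgebra.ι F (Sum.inl i)

/-- the odd variable `z_{j+1}` -/
def zv (j : ℕ) : FA F := FreeAlgebra.ι F (Sum.inr j)

/-- the constant term of an element of `F⟨Y,Z⟩` -/
def constTerm : FA F →ₐ[F] F := FreeAlgebra.lift F (fun _ => (0 : F))

/-- the commutator `[a,b] = ab - ba` -/
def brk {R : Type} [Ring R] (a b : R) : R := a * b - b * a

/-- the left-normed commutator `[a, l₁, l₂, …]` -/
def lnc {R : Type} [Ring R] (a : R) (l : List R) : R := l.foldl brk a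

section SuperAlg

variable (B : Type) [Ring B] [Algebra F B]

/-- the center of the (possibly non-unital) subalgebra of `B` whose underlying
subspace is `S`, as a submodule of `B` -/
def centerIn (S : Submodule F B) : Submodule F B where
  carrier := {x | x ∈ S ∧ ∀ y ∈ S, x * y = y * x}
  add_mem' := by
    rintro a b ⟨ha, ha'⟩ ⟨hb, hb'⟩
    exact ⟨S.add_mem ha hb, fun y hy => by rw [add_mul, mul_add, ha' y hy, hb' y hy]⟩
  zero_mem' := ⟨S.zero_mem, fun y _ => by rw [zero_mul, mul_zero]⟩
  smul_mem' := by
    rintro c a ⟨ha, ha'⟩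
    exact ⟨S.smul_mem c ha, fun y hy => by rw [smul_mul_assoc, mul_smul_comm, ha' y hy]⟩

variable (A0 A1 : Submodule F B)

/-- a graded substitution: an algebra evaluation sending each `yᵢ` into the even
component `A0` and each `zⱼ` into the odd component `A1` -/
def IsGSubst (φ : FA F →ₐ[F] B) : Prop :=
  (∀ i, φ (yv F i) ∈ A0) ∧ (∀ j, φ (zv F j) ∈ A1)

/-- the graded identities of the superalgebra with even part `A0` and odd part `A1` -/
def IdGr : Submodule F (FA F) where
  carrier := {f | ∀ φ : FA F →ₐ[F] B, IsGSubst F B A0 A1 φ → φ f = 0}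
  add_mem' := by
    intro f g hf hg φ hφ
    rw [map_add, hf φ hφ, hg φ hφ, add_zero]
  zero_mem' := fun φ _ => map_zero φ
  smul_mem' := by
    intro c f hf φ hφ
    rw [map_smul, hf φ hφ, smul_zero]

/-- the central graded polynomials of the superalgebra with even part `A0` and
odd part `A1`: the polynomials with zero constant term all of whose graded
evaluations lie in the center of the superalgebra -/
def CGr : Submodule F (FA F) where
  carrier := {f | constTerm F f = 0 ∧
    ∀ φ : FA F →ₐ[F] B, IsGSubst F B A0 A1 φ → φ f ∈ centerIn F B (A0 ⊔ A1)}
  add_mem' := by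
    rintro f g ⟨hf0, hf⟩ ⟨hg0, hg⟩
    refine ⟨by rw [map_add, hf0, hg0, add_zero], fun φ hφ => ?_⟩
    rw [map_add]
    exact (centerIn F B (A0 ⊔ A1)).add_mem (hf φ hφ) (hg φ hφ)
  zero_mem' :=
    ⟨map_zero _, fun φ _ => by
      rw [map_zero]; exact (centerIn F B (A0 ⊔ A1)).zero_mem⟩
  smul_mem' := by
    rintro c f ⟨hf0, hf⟩
    refine ⟨by rw [map_smul, hf0, smul_zero], fun φ hφ => ?_⟩
    rw [map_smul]
    exact (centerIn F B (A0 ⊔ A1)).smul_mem c (hf φ hφ)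

end SuperAlg

/-- the space `P_n^{gr}` of multilinear graded polynomials of degree `n`,
spanned by `w_{σ(1)} ⋯ w_{σ(n)}` with `wᵢ ∈ {yᵢ, zᵢ}` -/
def PnGr (n : ℕ) : Submodule F (FA F) :=
  Submodule.span F
    {m : FA F | ∃ (σ : Equiv.Perm (Fin n)) (w : Fin n → Bool),
      m = (List.ofFn fun i : Fin n =>
        if w (σ i) then zv F (σ i).val else yv F (σ i).val).prod}

/-- `dim P / (P ∩ C)` -/
def scodim (P C : Submodule F (FA F)) : ℕ :=
  Module.finrank F (↥P ⧸ Submodule.comap P.subtype C)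

/-- `dim (P ⊓ C) / (P ⊓ I)` -/
def deltaDim (P C I : Submodule F (FA F)) : ℕ :=
  Module.finrank F (↥(P ⊓ C) ⧸ Submodule.comap (P ⊓ C).subtype (P ⊓ I))

/-- the parity automorphism of `F⟨Y,Z⟩`, fixing the `yᵢ` and negating the `zⱼ` -/
def omegaFA : FA F →ₐ[F] FA F :=
  FreeAlgebra.lift F (fun v => match v with
    | Sum.inl i => FreeAlgebra.ι F (Sum.inl i)
    | Sum.inr j => - FreeAlgebra.ι F (Sum.inr j))

/-- an even (degree-0) element of the free superalgebra -/
def IsEvenFA (f : FA F) : Prop := omegaFA F f = f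

/-- an odd (degree-1) element of the free superalgebra -/
def IsOddFA (f : FA F) : Prop := omegaFA F f = - f

/-- a graded endomorphism of the free superalgebra: sends `Y`-variables to even
elements and `Z`-variables to odd elements -/
def IsT2Endo (φ : FA F →ₐ[F] FA F) : Prop :=
  (∀ i, IsEvenFA F (φ (yv F i))) ∧ (∀ j, IsOddFA F (φ (zv F j)))

/-- a T₂-space: a subspace invariant under all graded endomorphisms -/
def IsT2Space (V : Submodule F (FA F)) : Prop :=
  ∀ φ : FA F →ₐ[F] FA F, IsT2Endo F φ → ∀ f ∈ V, φ f ∈ V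

/-- the smallest T₂-space of `F⟨Y,Z⟩` containing `S` -/
def T2SpaceGen (S : Set (FA F)) : Submodule F (FA F) :=
  sInf {V : Submodule F (FA F) | S ⊆ ↑V ∧ IsT2Space F V}

/-- a T₂-ideal: a two-sided ideal invariant under all graded endomorphisms -/
def IsT2Ideal (I : Submodule F (FA F)) : Prop :=
  (∀ f ∈ I, ∀ g : FA F, g * f ∈ I ∧ f * g ∈ I) ∧ IsT2Space F I

/-- the smallest T₂-ideal of `F⟨Y,Z⟩` containing `S` -/
def T2IdealGen (S : Set (FA F)) : Submodule F (FA F) :=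
  sInf {I : Submodule F (FA F) | S ⊆ ↑I ∧ IsT2Ideal F I}

/-- the products `z_{i₁}⋯z_{i_k} · w₁⋯w_s` where every `wⱼ` is a left-normed
commutator of weight ≥ 2 in the variables and `k + s ≥ 1`; proper
ℤ₂-polynomials are the linear combinations of these -/
def properProds : Set (FA F) :=
  {p | ∃ (zs : List ℕ) (ws : List (FA F)),
      (∀ w ∈ ws, ∃ (v : ℕ ⊕ ℕ) (l : List (ℕ ⊕ ℕ)), l ≠ [] ∧
        w = lnc (FreeAlgebra.ι F v) (l.map (FreeAlgebra.ι F))) ∧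
      1 ≤ zs.length + ws.length ∧
      p = (zs.map (zv F)).prod * ws.prod}

/-- the Jacobson radical `J(A)`, as an `F`-submodule of `A` -/
def Jrad (A : Type) [Ring A] [Algebra F A] : Submodule F A :=
  Submodule.restrictScalars F ((⊥ : Ideal A).jacobson)

/-- `J' = J(A) ∩ Z(A)` -/
def Jprime (A : Type) [Ring A] [Algebra F A] : Submodule F A :=
  Jrad F A ⊓ Subalgebra.toSubmodule (Subalgebra.center F A)

/-- the matrix unit `e_{i+1,j+1}` (0-indexed position `(i,j)`) -/
def eMat (k i j : ℕ) : Matrix (Fin k) (Fin k) F :=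
  Matrix.of fun a b => if (a : ℕ) = i ∧ (b : ℕ) = j then 1 else 0

/-- the matrix `E = e_{12} + e_{23} + ⋯ + e_{k-1,k}` -/
def EMat (k : ℕ) : Matrix (Fin k) (Fin k) F :=
  Matrix.of fun a b => if (a : ℕ) + 1 = (b : ℕ) then 1 else 0

/-- `N_k = span_F{I_k, E, …, E^{k-2}, e_{12}, …, e_{1k}}` -/
def NkSub (k : ℕ) : Submodule F (Matrix (Fin k) (Fin k) F) :=
  Submodule.span F
    ({1} ∪ {x | ∃ m, 1 ≤ m ∧ m ≤ k - 2 ∧ x = EMat F k ^ m}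
      ∪ {x | ∃ j, 1 ≤ j ∧ j ≤ k - 1 ∧ x = eMat F k 0 j})

/-- `A_k = span_F{e_{11}, E, …, E^{k-2}, e_{12}, …, e_{1k}}` -/
def AkSub (k : ℕ) : Submodule F (Matrix (Fin k) (Fin k) F) :=
  Submodule.span F
    ({eMat F k 0 0} ∪ {x | ∃ m, 1 ≤ m ∧ m ≤ k - 2 ∧ x = EMat F k ^ m}
      ∪ {x | ∃ j, 1 ≤ j ∧ j ≤ k - 1 ∧ x = eMat F k 0 j})

/-- `B_k = span_F{e_{kk}, E, …, E^{k-2}, e_{1k}, …, e_{k-1,k}}` -/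
def BkSub (k : ℕ) : Submodule F (Matrix (Fin k) (Fin k) F) :=
  Submodule.span F
    ({eMat F k (k - 1) (k - 1)} ∪ {x | ∃ m, 1 ≤ m ∧ m ≤ k - 2 ∧ x = EMat F k ^ m}
      ∪ {x | ∃ i, i ≤ k - 2 ∧ x = eMat F k i (k - 1)})

/-- the even part of `Matrix (Fin k) (Fin k) F` under the elementary ℤ₂-grading
induced by `(0,1,…,1)`: matrices vanishing at the odd positions `(i,j)`
(those where exactly one of `i`, `j` equals the first index) -/
def matEvenPart (k : ℕ) : Submodule F (Matrix (Fin k) (Fin k) F) where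
  carrier := {x | ∀ i j : Fin k, (((i : ℕ) = 0) ↔ ¬((j : ℕ) = 0)) → x i j = 0}
  add_mem' := by
    intro a b ha hb i j h
    simp [Matrix.add_apply, ha i j h, hb i j h]
  zero_mem' := by intro i j _; simp
  smul_mem' := by
    intro c a ha i j h
    simp [Matrix.smul_apply, ha i j h]

/-- the odd part of `Matrix (Fin k) (Fin k) F` under the elementary ℤ₂-grading
induced by `(0,1,…,1)`: matrices vanishing at the even positions -/
def matOddPart (k : ℕ) : Submodule F (Matrix (Fin k) (Fin k) F) where
  carrier := {x | ∀ i j : Fin k, (((i : ℕ) = 0) ↔ ((j : ℕ) = 0)) → x i j = 0}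
  add_mem' := by
    intro a b ha hb i j h
    simp [Matrix.add_apply, ha i j h, hb i j h]
  zero_mem' := by intro i j _; simp
  smul_mem' := by
    intro c a ha i j h
    simp [Matrix.smul_apply, ha i j h]

section Grassmann

variable (M : Type) [AddCommGroup M] [Module F M]

/-- the main involution of the Grassmann (exterior) algebra, negating the
generators -/
def grassInvol : ExteriorAlgebra F M →ₐ[F] ExteriorAlgebra F M :=
  ExteriorAlgebra.lift F ⟨-(ExteriorAlgebra.ι F (M := M)), fun m => by
    simp [ExteriorAlgebra.ι_sq_zero]⟩

/-- the even (degree-0) part of the canonical ℤ₂-grading of the Grassmann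
algebra: the span of `1` and the products of the generators of even length -/
def grEven : Submodule F (ExteriorAlgebra F M) :=
  LinearMap.ker ((grassInvol F M).toLinearMap - LinearMap.id)

/-- the odd (degree-1) part of the canonical ℤ₂-grading of the Grassmann
algebra: the span of the products of the generators of odd length -/
def grOdd : Submodule F (ExteriorAlgebra F M) :=
  LinearMap.ker ((grassInvol F M).toLinearMap + LinearMap.id)

end Grassmann

end

section Helpers

variable {F : Type} [Field F] {M N : Type} [AddCommGroup M] [Module F M]
  [AddCommGroup N] [Module F N]

open ExteriorAlgebra

lemma invol_ι (m : M) : grassInvol F M (ι F m) = -ι F m := by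
  simp [grassInvol]

lemma invol_map (g : M →ₗ[F] N) (x : ExteriorAlgebra F M) :
    grassInvol F N (map g x) = map g (grassInvol F M x) := by
  have h : (grassInvol F N).comp (map g) = (map g).comp (grassInvol F M) := by
    ext m
    simp [invol_ι]
  exact DFunLike.congr_fun h x

lemma invol_eq (x : ExteriorAlgebra F M) :
    grassInvol F M x = map (-LinearMap.id : M →ₗ[F] M) x := by
  have h : grassInvol F M = map (-LinearMap.id : M →ₗ[F] M) := by
    ext m
    simp [invol_ι]
  rw [h]

lemma invol_invol (x : ExteriorAlgebra F M) : grassInvol F M (grassInvol F M x) = x := by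
  have h : (grassInvol F M).comp (grassInvol F M) = AlgHom.id F _ := by
    ext m
    simp [invol_ι]
  exact DFunLike.congr_fun h x

lemma mem_even (x : ExteriorAlgebra F M) : x ∈ grEven F M ↔ grassInvol F M x = x := by
  simp [grEven, sub_eq_zero]

lemma mem_odd (x : ExteriorAlgebra F M) : x ∈ grOdd F M ↔ grassInvol F M x = -x := by
  simp [grOdd, add_eq_zero_iff_eq_neg]

lemma ι_anticomm (v w : M) : ι F v * ι F w = -(ι F w * ι F v) :=
  eq_neg_of_add_eq_zero_left (ι_add_mul_swap v w)

lemma ι_mul_eq (v : M) (x : ExteriorAlgebra F M) :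
    ι F v * x = grassInvol F M x * ι F v := by
  induction x using ExteriorAlgebra.induction with
  | algebraMap r => simp [Algebra.commutes]
  | ι w => rw [invol_ι, ι_anticomm]; simp
  | mul a b ha hb => rw [map_mul, ← mul_assoc, ha, mul_assoc, hb, mul_assoc]
  | add a b ha hb => rw [map_add, mul_add, add_mul, ha, hb]

lemma ι_mul_map (a : M) (g : M →ₗ[F] M) (hg : ∀ v, ∃ c : F, g v = v + c • a)
    (x : ExteriorAlgebra F M) : ι F a * map g x = ι F a * x := by
  induction x using ExteriorAlgebra.induction with
  | algebraMap r => simp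
  | ι w =>
    obtain ⟨c, hc⟩ := hg w
    simp [hc, mul_add, ι_sq_zero]
  | mul x y hx hy =>
    rw [map_mul, ← mul_assoc, hx, ι_mul_eq, mul_assoc, hy, ← mul_assoc, ← ι_mul_eq, mul_assoc]
  | add x y hx hy => rw [map_add, mul_add, mul_add, hx, hy]

lemma sup_eq_top [CharZero F] : grEven F M ⊔ grOdd F M = ⊤ := by
  rw [eq_top_iff]
  intro x _
  rw [Submodule.mem_sup]
  refine ⟨(2⁻¹ : F) • (x + grassInvol F M x), ?_, (2⁻¹ : F) • (x - grassInvol F M x), ?_, ?_⟩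
  · rw [mem_even, map_smul, map_add, invol_invol, add_comm]
  · rw [mem_odd, map_smul, map_sub, invol_invol, ← smul_neg, neg_sub]
  · rw [← smul_add, add_add_sub_cancel, ← two_smul F x, smul_smul]
    simp

/-- an element commutes with everything iff its odd part is killed by the generators -/
lemma central_iff (x : ExteriorAlgebra F M) :
    (∀ y, x * y = y * x) ↔ ∀ v, ι F v * (x - grassInvol F M x) = 0 := by
  constructor
  · intro h v
    have h1 := h (ι F v)
    rw [ι_mul_eq v x] at h1
    rw [ι_mul_eq v, map_sub, invol_invol, sub_mul, h1, sub_self]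
  · intro h y
    have key : ∀ v, x * ι F v = ι F v * x := by
      intro v
      have := h v
      rw [ι_mul_eq v, map_sub, invol_invol, sub_mul, sub_eq_zero] at this
      rw [← this, ι_mul_eq]
    induction y using ExteriorAlgebra.induction with
    | algebraMap r => exact (Algebra.commutes r x).symm
    | ι w => exact key w
    | mul a b ha hb => rw [← mul_assoc, ha, mul_assoc, hb, mul_assoc]
    | add a b ha hb => rw [mul_add, add_mul, ha, hb]

lemma mem_centerIn_iff [CharZero F] (x : ExteriorAlgebra F M) :
    x ∈ centerIn F (ExteriorAlgebra F M) (grEven F M ⊔ grOdd F M) ↔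
      ∀ v, ι F v * (x - grassInvol F M x) = 0 := by
  rw [← central_iff, sup_eq_top]
  change (x ∈ (⊤ : Submodule F _) ∧ ∀ y ∈ (⊤ : Submodule F _), _) ↔ _
  simp

lemma gsubst_map (g : M →ₗ[F] N) (φ : FA F →ₐ[F] ExteriorAlgebra F M)
    (hφ : IsGSubst F (ExteriorAlgebra F M) (grEven F M) (grOdd F M) φ) :
    IsGSubst F (ExteriorAlgebra F N) (grEven F N) (grOdd F N) ((map g).comp φ) := by
  constructor
  · intro i
    have := (mem_even _).1 (hφ.1 i)
    rw [mem_even, AlgHom.comp_apply, invol_map, this]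
  · intro i
    have := (mem_odd _).1 (hφ.2 i)
    rw [mem_odd, AlgHom.comp_apply, invol_map, this, map_neg]

/-- negate the coordinates in `s` -/
def reflS (F : Type) [Field F] {n : ℕ} (s : Finset (Fin n)) : (Fin n → F) →ₗ[F] (Fin n → F) :=
  LinearMap.pi fun j => if j ∈ s then -LinearMap.proj j else LinearMap.proj j

lemma reflS_apply {n : ℕ} (s : Finset (Fin n)) (v : Fin n → F) (j : Fin n) :
    reflS F s v j = if j ∈ s then -v j else v j := by
  simp only [reflS, LinearMap.pi_apply]
  split <;> simp

lemma eq_zero_of_killed [CharZero F] {n : ℕ} (hn : Even n)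
    (u : ExteriorAlgebra F (Fin n → F)) (hu : grassInvol F _ u = -u)
    (h : ∀ v, ι F v * u = 0) : u = 0 := by
  have h1 : ∀ i : Fin n, ∃ w, u = ι F (Pi.single i 1 : Fin n → F) * w := by
    intro i
    have := congrArg (CliffordAlgebra.contractLeft (Q := (0 : QuadraticForm F (Fin n → F)))
      (LinearMap.proj i)) (h (Pi.single i (1 : F)))
    erw [CliffordAlgebra.contractLeft_ι_mul] at this
    simp [sub_eq_zero] at this
    exact ⟨_, this⟩
  have h2 : ∀ s : Finset (Fin n), map (reflS F s) u = (-1 : F) ^ s.card • u := by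
    intro s
    induction s using Finset.induction_on with
    | empty =>
      have : reflS F (∅ : Finset (Fin n)) = LinearMap.id := by
        ext v j; simp [reflS_apply]
      rw [this]; simp
    | insert i s hi ih =>
      have hc : reflS F (insert i s) = (reflS F {i}) ∘ₗ (reflS F s) := by
        refine LinearMap.ext fun v => funext fun j => ?_
        simp only [reflS_apply, LinearMap.comp_apply, Finset.mem_insert, Finset.mem_singleton]
        by_cases hj : j = i
        · subst hj; simp [hi]
        · simp [hj]
      have h3 : map (reflS F {i}) u = -u := by
        obtain ⟨w, hw⟩ := h1 i
        have h4 : reflS F {i} (Pi.single i (1 : F)) = -(Pi.single i (1 : F)) := by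
          funext j
          simp only [reflS_apply, Finset.mem_singleton, Pi.neg_apply]
          by_cases hj : j = i
          · simp [hj]
          · simp [hj]
        rw [hw, map_mul, map_apply_ι, h4, map_neg, neg_mul, ι_mul_map]
        intro v
        refine ⟨-2 * v i, funext fun j => ?_⟩
        simp only [reflS_apply, Finset.mem_singleton, Pi.add_apply, Pi.smul_apply, smul_eq_mul]
        by_cases hj : j = i
        · subst hj; simp; ring
        · simp [hj]
      rw [hc, ← map_comp_map, AlgHom.comp_apply, ih, map_smul, h3,
        Finset.card_insert_of_notMem hi, pow_succ]
      simp
  have h5 : reflS F (Finset.univ : Finset (Fin n)) = -LinearMap.id := by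
    refine LinearMap.ext fun v => funext fun j => ?_
    simp [reflS_apply]
  have h6 := h2 Finset.univ
  rw [h5, ← invol_eq, hu, Finset.card_univ, Fintype.card_fin, hn.neg_one_pow, one_smul] at h6
  have h7 : (2 : F) • u = 0 := by
    rw [two_smul]; nth_rewrite 1 [← h6]; simp
  simpa using h7

lemma invol_eq_of_central [CharZero F] {n : ℕ} (hn : Even n)
    (x : ExteriorAlgebra F (Fin n → F)) (h : ∀ v, ι F v * (x - grassInvol F _ x) = 0) :
    x - grassInvol F _ x = 0 :=
  eq_zero_of_killed hn _ (by rw [map_sub, invol_invol, neg_sub]) h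

/-- drop coordinate `i` -/
def dropL (F : Type) [Field F] {n : ℕ} (i : Fin (n + 1)) : (Fin (n + 1) → F) →ₗ[F] (Fin n → F) :=
  LinearMap.funLeft F F i.succAbove

/-- insert zero at coordinate `i` -/
def insL (F : Type) [Field F] {n : ℕ} (i : Fin (n + 1)) : (Fin n → F) →ₗ[F] (Fin (n + 1) → F) where
  toFun v := i.insertNth 0 v
  map_add' v w := by
    funext j
    refine Fin.succAboveCases i ?_ (fun j => ?_) j <;> simp
  map_smul' c v := by
    funext j
    refine Fin.succAboveCases i ?_ (fun j => ?_) j <;> simp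

lemma drop_ins {n : ℕ} (i : Fin (n + 1)) : dropL F i ∘ₗ insL F i = LinearMap.id := by
  refine LinearMap.ext fun v => funext fun j => ?_
  simp [dropL, insL, LinearMap.funLeft]

lemma ins_drop {n : ℕ} (i : Fin (n + 1)) (v : Fin (n + 1) → F) :
    ∃ c : F, (insL F i ∘ₗ dropL F i) v = v + c • Pi.single i 1 := by
  refine ⟨-v i, funext fun j => ?_⟩
  refine Fin.succAboveCases i ?_ (fun j => ?_) j <;> simp [dropL, insL, LinearMap.funLeft]

lemma odd_mem [CharZero F] (x : ExteriorAlgebra F M) (hx : grassInvol F M x = -x) :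
    x ∈ LinearMap.range (ι F (M := M)) * ⊤ := by
  have key : ∀ y : ExteriorAlgebra F M,
      y - grassInvol F M y ∈ LinearMap.range (ι F (M := M)) * ⊤ := by
    intro y
    induction y using CliffordAlgebra.left_induction with
    | algebraMap r => erw [AlgHom.commutes]; simp
    | add a b ha hb =>
      rw [map_add, add_sub_add_comm]
      exact Submodule.add_mem _ ha hb
    | ι_mul a m _ =>
      have : ι F m * a - grassInvol F M (ι F m * a) = ι F m * (a + grassInvol F M a) := by
        rw [map_mul, invol_ι]; noncomm_ring
      erw [this]
      exact Submodule.mul_mem_mul ⟨m, rfl⟩ trivial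
  have h := key x
  rw [hx, sub_neg_eq_add, ← two_smul F x] at h
  have := Submodule.smul_mem _ (2⁻¹ : F) h
  rwa [smul_smul, inv_mul_cancel₀ two_ne_zero, one_smul] at this

lemma top_mul_range : (⊤ : Submodule F (ExteriorAlgebra F M)) * LinearMap.range (ι F (M := M)) ≤
    LinearMap.range (ι F (M := M)) * ⊤ := by
  rw [Submodule.mul_le]
  rintro x - _ ⟨m, rfl⟩
  have := ι_mul_eq m (grassInvol F M x)
  rw [invol_invol] at this
  rw [← this]
  exact Submodule.mul_mem_mul ⟨m, rfl⟩ trivial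

lemma odd_prod_mem [CharZero F] (l : List (ExteriorAlgebra F M))
    (hl : ∀ x ∈ l, grassInvol F M x = -x) :
    l.prod ∈ LinearMap.range (ι F (M := M)) ^ l.length * ⊤ := by
  induction l with
  | nil => simp
  | cons a l ih =>
    rw [List.prod_cons, List.length_cons]
    have h1 := odd_mem a (hl a (by simp))
    have h2 := ih fun x hx => hl x (by simp [hx])
    have h3 := Submodule.mul_mem_mul h1 h2
    have h4 : ∀ m : ℕ, (⊤ : Submodule F (ExteriorAlgebra F M)) *
        LinearMap.range (ι F (M := M)) ^ m ≤ LinearMap.range (ι F (M := M)) ^ m * ⊤ := by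
      intro m
      induction m with
      | zero => simp
      | succ m ihm =>
        rw [pow_succ, ← mul_assoc]
        refine (mul_le_mul' ihm le_rfl).trans ?_
        rw [mul_assoc, mul_assoc]
        exact mul_le_mul' le_rfl top_mul_range
    refine SetLike.le_def.1 ?_ h3
    rw [pow_succ', mul_assoc, mul_assoc]
    refine mul_le_mul' le_rfl ?_
    rw [← mul_assoc]
    refine (mul_le_mul' (h4 _) le_rfl).trans ?_
    rw [mul_assoc]
    exact mul_le_mul' le_rfl le_top

lemma range_pow_eq_bot (n : ℕ) :
    LinearMap.range (ι F (M := Fin n → F)) ^ (n + 1) = ⊥ := by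
  rw [eq_bot_iff]
  have := ιMulti_span_fixedDegree F (M := Fin n → F) (n + 1)
  rw [exteriorPower] at this
  rw [← this, Submodule.span_le]
  rintro _ ⟨v, rfl⟩
  refine AlternatingMap.map_linearDependent _ _ fun h => ?_
  have := h.fintype_card_le_finrank
  simp at this

end Helpers

theorem stmt15 (F : Type) [Field F] [CharZero F] (k : ℕ) (hk : 1 ≤ k) :
    CGr F (ExteriorAlgebra F (Fin (2 * k) → F))
        (grEven F (Fin (2 * k) → F)) (grOdd F (Fin (2 * k) → F)) =
      CGr F (ExteriorAlgebra F (Fin (2 * k + 1) → F))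
        (grEven F (Fin (2 * k + 1) → F)) (grOdd F (Fin (2 * k + 1) → F)) ∧
    IdGr F (ExteriorAlgebra F (Fin (2 * k) → F))
        (grEven F (Fin (2 * k) → F)) (grOdd F (Fin (2 * k) → F)) ≠
      IdGr F (ExteriorAlgebra F (Fin (2 * k + 1) → F))
        (grEven F (Fin (2 * k + 1) → F)) (grOdd F (Fin (2 * k + 1) → F)) := by
  constructor
  · ext f
    constructor
    · rintro ⟨h0, h⟩
      refine ⟨h0, fun φ hφ => ?_⟩
      rw [mem_centerIn_iff]
      have key : ∀ i : Fin (2 * k + 1),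
          ExteriorAlgebra.ι F (Pi.single i 1) * (φ f - grassInvol F _ (φ f)) = 0 := by
        intro i
        have h1 := h _ (gsubst_map (dropL F i) φ hφ)
        rw [mem_centerIn_iff] at h1
        have h2 := invol_eq_of_central (even_two_mul k) _ h1
        rw [AlgHom.comp_apply, invol_map, ← map_sub] at h2
        rw [← ι_mul_map _ (insL F i ∘ₗ dropL F i) (ins_drop i),
          ← ExteriorAlgebra.map_comp_map, AlgHom.comp_apply, h2, map_zero, mul_zero]
      intro v
      have hv : v = ∑ i, v i • Pi.single i (1 : F) := by
        simpa using (pi_eq_sum_univ' v)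
      rw [hv, map_sum, Finset.sum_mul]
      refine Finset.sum_eq_zero fun i _ => ?_
      rw [map_smul, smul_mul_assoc, key, smul_zero]
    · rintro ⟨h0, h⟩
      refine ⟨h0, fun φ hφ => ?_⟩
      rw [mem_centerIn_iff]
      intro v
      have h1 := h _ (gsubst_map (insL F 0) φ hφ)
      rw [mem_centerIn_iff] at h1
      have h2 := congrArg (ExteriorAlgebra.map (dropL F 0)) (h1 (insL F 0 v))
      rw [AlgHom.comp_apply, invol_map, ← map_sub, ← ExteriorAlgebra.map_apply_ι, ← map_mul,
        ← AlgHom.comp_apply, ExteriorAlgebra.map_comp_map, drop_ins] at h2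
      simpa using h2
  · intro heq
    have hf : ((List.ofFn fun i : Fin (2 * k + 1) => zv F i.val).prod) ∈
        IdGr F (ExteriorAlgebra F (Fin (2 * k) → F))
        (grEven F (Fin (2 * k) → F)) (grOdd F (Fin (2 * k) → F)) := by
      intro φ hφ
      rw [map_list_prod, List.map_ofFn]
      have h1 := odd_prod_mem (List.ofFn (φ ∘ fun i : Fin (2 * k + 1) => zv F i.val)) (by
        intro x hx
        rw [List.mem_ofFn] at hx
        obtain ⟨i, rfl⟩ := hx
        exact (mem_odd _).1 (hφ.2 i))
      rw [List.length_ofFn, range_pow_eq_bot] at h1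
      simpa using h1
    rw [heq] at hf
    let φ : FA F →ₐ[F] ExteriorAlgebra F (Fin (2 * k + 1) → F) :=
      FreeAlgebra.lift F (Sum.elim (fun _ => 0) (fun j =>
        if h : j < 2 * k + 1 then ExteriorAlgebra.ι F (Pi.single ⟨j, h⟩ 1) else 0))
    have hφz : ∀ j, φ (zv F j) =
        if h : j < 2 * k + 1 then ExteriorAlgebra.ι F (Pi.single ⟨j, h⟩ 1) else 0 := by
      intro j
      simp [φ, zv]
    have h1 := hf φ ⟨fun i => by simp [φ, yv], fun j => by
      rw [mem_odd, hφz]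
      split
      · exact invol_ι _
      · simp⟩
    rw [map_list_prod, List.map_ofFn] at h1
    have h2 : (φ ∘ fun i : Fin (2 * k + 1) => zv F i.val) =
        fun i => ExteriorAlgebra.ι F (Pi.single i 1) := by
      funext i
      rw [Function.comp_apply, hφz, dif_pos i.isLt]
    rw [h2, ← ExteriorAlgebra.ιMulti_apply] at h1
    have h3 := congrArg (ExteriorAlgebra.liftAlternating (R := F)
      (Pi.single (2 * k + 1) (Matrix.detRowAlternating (R := F) (n := Fin (2 * k + 1))))) h1
    rw [ExteriorAlgebra.liftAlternating_apply_ιMulti, map_zero, Pi.single_eq_same] at h3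
    have h4 : (fun i : Fin (2 * k + 1) => (Pi.single i 1 : Fin (2 * k + 1) → F)) =
        (1 : Matrix _ _ F) := by
      funext i j
      rw [Matrix.one_apply, Pi.single_apply]
      simp [eq_comm]
    rw [h4] at h3
    have h5 : Matrix.det (1 : Matrix (Fin (2 * k + 1)) (Fin (2 * k + 1)) F) = 0 := h3
    simp at h5
end

section
/- For every k ≥ 1 and every n ≥ 1: c_n^{gr,z}(G_{2k}^{gr}) = c_n^{gr,z}(G_{2k+1}^{gr}) = Σ_{i odd, 1 ≤ i ≤ 2k−1} C(n,i); δ_n^{gr}(G_{2k}^{gr}) = Σ_{i even, 0 ≤ i ≤ 2k} C(n,i); and δ_n^{gr}(G_{2k+1}^{gr}) = C(n, 2k+1) + Σ_{i even, 0 ≤ i ≤ 2k} C(n,i). -/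
namespace GrAux

open ExteriorAlgebra

section Ext

variable {F : Type} [Field F] {M : Type} [AddCommGroup M] [Module F M]

lemma inv_ι (m : M) : grassInvol F M (ι F m) = - ι F m := by
  simp [grassInvol]

lemma inv_inv (x : ExteriorAlgebra F M) : grassInvol F M (grassInvol F M x) = x := by
  induction x using ExteriorAlgebra.induction with
  | algebraMap r => simp
  | ι m => simp [inv_ι]
  | mul a b ha hb => simp [ha, hb]
  | add a b ha hb => simp [ha, hb]

lemma mem_even {x : ExteriorAlgebra F M} : x ∈ grEven F M ↔ grassInvol F M x = x := by
  simp [grEven, sub_eq_zero]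

lemma mem_odd {x : ExteriorAlgebra F M} : x ∈ grOdd F M ↔ grassInvol F M x = - x := by
  simp [grOdd, add_eq_zero_iff_eq_neg]

lemma ι_mem_odd (m : M) : ι F m ∈ grOdd F M := mem_odd.2 (inv_ι m)

lemma ι_mul (m : M) (x : ExteriorAlgebra F M) : ι F m * x = grassInvol F M x * ι F m := by
  induction x using ExteriorAlgebra.induction with
  | algebraMap r => simp [Algebra.commutes]
  | ι m' => rw [inv_ι, neg_mul, eq_neg_iff_add_eq_zero, ι_add_mul_swap]
  | mul a b ha hb => rw [← mul_assoc, ha, mul_assoc, hb, map_mul, mul_assoc]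
  | add a b ha hb => rw [mul_add, ha, hb, map_add, add_mul]

lemma comm_of_ι {a : ExteriorAlgebra F M} (h : ∀ m, a * ι F m = ι F m * a)
    (x : ExteriorAlgebra F M) : a * x = x * a := by
  induction x using ExteriorAlgebra.induction with
  | algebraMap r => rw [Algebra.commutes]
  | ι m' => exact h m'
  | mul x y hx hy => rw [← mul_assoc, hx, mul_assoc, hy, mul_assoc]
  | add x y hx hy => rw [mul_add, hx, hy, add_mul]

lemma even_comm {a : ExteriorAlgebra F M} (ha : a ∈ grEven F M) (x : ExteriorAlgebra F M) :
    a * x = x * a :=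
  comm_of_ι (fun m => by rw [ι_mul, mem_even.1 ha]) x

lemma odd_mul {a : ExteriorAlgebra F M} (ha : a ∈ grOdd F M) (x : ExteriorAlgebra F M) :
    a * x = grassInvol F M x * a := by
  induction x using ExteriorAlgebra.induction with
  | algebraMap r => rw [AlgHom.commutes, Algebra.commutes]
  | ι m => rw [inv_ι, neg_mul, ι_mul, mem_odd.1 ha, neg_mul, neg_neg]
  | mul x y hx hy => rw [← mul_assoc, hx, mul_assoc, hy, map_mul, mul_assoc]
  | add x y hx hy => rw [mul_add, hx, hy, map_add, add_mul]

lemma odd_anti {a b : ExteriorAlgebra F M} (ha : a ∈ grOdd F M) (hb : b ∈ grOdd F M) :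
    a * b = - (b * a) := by
  rw [odd_mul ha, mem_odd.1 hb, neg_mul]

lemma sup_top [CharZero F] : grEven F M ⊔ grOdd F M = ⊤ := by
  rw [eq_top_iff]
  intro x _
  rw [Submodule.mem_sup]
  refine ⟨(2⁻¹ : F) • (x + grassInvol F M x), ?_, (2⁻¹ : F) • (x - grassInvol F M x), ?_, ?_⟩
  · rw [mem_even, map_smul, map_add, inv_inv, add_comm]
  · rw [mem_odd, map_smul, map_sub, inv_inv, ← smul_neg, neg_sub]
  · rw [← smul_add, add_add_sub_cancel, ← two_smul F x, smul_smul]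
    norm_num

/-- the generator space -/
abbrev Rg (F : Type) [Field F] (M : Type) [AddCommGroup M] [Module F M] :
    Submodule F (ExteriorAlgebra F M) := LinearMap.range (ι F (M := M))

lemma top_mul_Rg : (⊤ : Submodule F (ExteriorAlgebra F M)) * Rg F M ≤ Rg F M * ⊤ := by
  rw [Submodule.mul_le]
  rintro x - _ ⟨m, rfl⟩
  have := ι_mul m (grassInvol F M x)
  rw [inv_inv] at this
  rw [← this]
  exact Submodule.mul_mem_mul ⟨m, rfl⟩ trivial

lemma top_mul_top : (⊤ : Submodule F (ExteriorAlgebra F M)) * ⊤ = ⊤ := by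
  rw [eq_top_iff]
  intro x _
  rw [← one_mul x]
  exact Submodule.mul_mem_mul trivial trivial

lemma top_mul_pow (r : ℕ) :
    (⊤ : Submodule F (ExteriorAlgebra F M)) * Rg F M ^ r ≤ Rg F M ^ r * ⊤ := by
  induction r with
  | zero => simp
  | succ r ih =>
    calc (⊤ : Submodule F (ExteriorAlgebra F M)) * Rg F M ^ (r + 1)
        = (⊤ * Rg F M ^ r) * Rg F M := by rw [pow_succ, mul_assoc]
      _ ≤ (Rg F M ^ r * ⊤) * Rg F M := mul_le_mul' ih le_rfl
      _ = Rg F M ^ r * (⊤ * Rg F M) := by rw [mul_assoc]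
      _ ≤ Rg F M ^ r * (Rg F M * ⊤) := mul_le_mul' le_rfl top_mul_Rg
      _ = Rg F M ^ (r + 1) * ⊤ := by rw [pow_succ, mul_assoc]

lemma any_mul_fil (r : ℕ) (a : ExteriorAlgebra F M) {x : ExteriorAlgebra F M}
    (hx : x ∈ Rg F M ^ r * ⊤) : a * x ∈ Rg F M ^ r * ⊤ := by
  have h : (⊤ : Submodule F (ExteriorAlgebra F M)) * (Rg F M ^ r * ⊤) ≤ Rg F M ^ r * ⊤ := by
    calc (⊤ : Submodule F (ExteriorAlgebra F M)) * (Rg F M ^ r * ⊤)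
        = (⊤ * Rg F M ^ r) * ⊤ := by rw [mul_assoc]
      _ ≤ (Rg F M ^ r * ⊤) * ⊤ := mul_le_mul' (top_mul_pow r) le_rfl
      _ = Rg F M ^ r * ⊤ := by rw [mul_assoc, top_mul_top]
  exact h (Submodule.mul_mem_mul trivial hx)

lemma aug_mem (x : ExteriorAlgebra F M) :
    x - algebraMap F _ (algebraMapInv x) ∈ Rg F M * ⊤ := by
  induction x using ExteriorAlgebra.induction with
  | algebraMap r => simp [algebraMapInv]
  | ι m =>
    have : ι F m * 1 ∈ Rg F M * ⊤ := Submodule.mul_mem_mul ⟨m, rfl⟩ trivial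
    simpa [algebraMapInv] using this
  | mul a b ha hb =>
    have e : a * b - algebraMap F (ExteriorAlgebra F M) (algebraMapInv (a * b)) =
      (a - algebraMap F _ (algebraMapInv a)) * b +
        algebraMap F _ (algebraMapInv a) * (b - algebraMap F _ (algebraMapInv b)) := by
      rw [map_mul, map_mul, sub_mul, mul_sub]; abel
    rw [e]
    refine Submodule.add_mem _ ?_ ?_
    · have := Submodule.mul_mem_mul ha (show b ∈ (⊤ : Submodule F _) from trivial)
      rwa [mul_assoc, top_mul_top] at this
    · rw [← Algebra.smul_def]
      exact Submodule.smul_mem _ _ hb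
  | add a b ha hb =>
    have := Submodule.add_mem _ ha hb
    rw [map_add, map_add]
    convert this using 1
    abel

lemma augInv_inv (x : ExteriorAlgebra F M) :
    algebraMapInv (grassInvol F M x) = algebraMapInv x := by
  induction x using ExteriorAlgebra.induction with
  | algebraMap r => simp
  | ι m => simp [inv_ι, algebraMapInv]
  | mul a b ha hb => simp [ha, hb]
  | add a b ha hb => simp [ha, hb]

lemma odd_mem_fil [CharZero F] {a : ExteriorAlgebra F M} (ha : a ∈ grOdd F M) :
    a ∈ Rg F M * ⊤ := by
  have h := augInv_inv a
  rw [mem_odd.1 ha, map_neg, neg_eq_iff_add_eq_zero, add_self_eq_zero] at h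
  have := aug_mem a
  rwa [h, map_zero, sub_zero] at this

lemma odd_mul_fil [CharZero F] {a : ExteriorAlgebra F M} (ha : a ∈ grOdd F M) (r : ℕ)
    {x : ExteriorAlgebra F M}
    (hx : x ∈ Rg F M ^ r * ⊤) : a * x ∈ Rg F M ^ (r + 1) * ⊤ := by
  have h : (Rg F M * ⊤) * (Rg F M ^ r * ⊤) ≤ Rg F M ^ (r + 1) * ⊤ := by
    calc (Rg F M * ⊤) * (Rg F M ^ r * ⊤)
        = Rg F M * ((⊤ * Rg F M ^ r) * ⊤) := by simp only [mul_assoc]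
      _ ≤ Rg F M * ((Rg F M ^ r * ⊤) * ⊤) :=
          mul_le_mul' le_rfl (mul_le_mul' (top_mul_pow r) le_rfl)
      _ = Rg F M ^ (r + 1) * ⊤ := by rw [mul_assoc, top_mul_top, pow_succ', mul_assoc]
  exact h (Submodule.mul_mem_mul (odd_mem_fil ha) hx)

lemma fil_zero {t r : ℕ} (h : t < r) : Rg F (Fin t → F) ^ r = ⊥ := by
  have := ιMulti_span_fixedDegree F (M := Fin t → F) r
  rw [eq_bot_iff]
  refine this.symm.le.trans ?_
  rw [Submodule.span_le]
  rintro _ ⟨v, rfl⟩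
  refine AlternatingMap.map_linearDependent _ v fun hv => ?_
  have := hv.fintype_card_le_finrank
  simp at this
  omega

/-- the generator `e_i` -/
abbrev e (F : Type) [Field F] {t : ℕ} (i : Fin t) : ExteriorAlgebra F (Fin t → F) :=
  ι F (Pi.single i (1 : F))

lemma top_prod_ne {t : ℕ} : ((List.finRange t).map (e F)).prod ≠ 0 := by
  intro h
  have h1 : ιMulti F t (fun i : Fin t => (Pi.single i (1 : F) : Fin t → F)) = 0 := by
    rw [ιMulti_apply, List.ofFn_eq_map, h]
  have h2 := liftAlternating_apply_ιMulti (R := F) (N := F)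
    (fun i => if hi : i = t then hi ▸ Matrix.detRowAlternating else 0)
    (fun i : Fin t => (Pi.single i (1 : F) : Fin t → F))
  rw [h1, map_zero] at h2
  simp only [dite_true] at h2
  have h3 : Matrix.detRowAlternating (fun i : Fin t => (Pi.single i (1 : F) : Fin t → F))
      = (1 : F) := by
    have : (fun i : Fin t => (Pi.single i (1 : F) : Fin t → F)) = (1 : Matrix (Fin t) (Fin t) F) := by
      ext i j
      simp [Matrix.one_apply, Pi.single_apply, eq_comm]
    rw [this]
    exact Matrix.det_one
  rw [h3] at h2
  exact zero_ne_one h2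

end Ext

section Mono

variable (F : Type) [Field F]

/-- the monomial of a list of variables -/
def mm (l : List (ℕ ⊕ ℕ)) : FA F := (l.map (FreeAlgebra.ι F)).prod

/-- the `i`-th variable: odd when `i ∈ s`, even otherwise -/
def mkv {n : ℕ} (s : Finset (Fin n)) (i : Fin n) : ℕ ⊕ ℕ :=
  if i ∈ s then Sum.inr i.val else Sum.inl i.val

/-- the ordered monomial with odd positions `s` -/
def mono {n : ℕ} (s : Finset (Fin n)) : FA F := mm F ((List.finRange n).map (mkv s))

/-- graded substitutions into the exterior algebra -/
abbrev GS (M : Type) [AddCommGroup M] [Module F M]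
    (φ : FA F →ₐ[F] ExteriorAlgebra F M) : Prop :=
  IsGSubst F (ExteriorAlgebra F M) (grEven F M) (grOdd F M) φ

variable {F} {M : Type} [AddCommGroup M] [Module F M]

lemma mm_cons (v : ℕ ⊕ ℕ) (l : List (ℕ ⊕ ℕ)) : mm F (v :: l) = FreeAlgebra.ι F v * mm F l := by
  simp [mm]

lemma perm_sign {l l' : List (ℕ ⊕ ℕ)} (h : l.Perm l') :
    ∃ c : F, ∀ φ : FA F →ₐ[F] ExteriorAlgebra F M, GS F M φ → φ (mm F l) = c • φ (mm F l') := by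
  induction h with
  | nil => exact ⟨1, fun φ _ => by simp⟩
  | cons v _ ih =>
    obtain ⟨c, hc⟩ := ih
    exact ⟨c, fun φ hφ => by rw [mm_cons, mm_cons, map_mul, map_mul, hc φ hφ, mul_smul_comm]⟩
  | swap u v l =>
    rcases u with u | u
    · refine ⟨1, fun φ hφ => ?_⟩
      have := even_comm (hφ.1 u) (φ (FreeAlgebra.ι F v))
      simp only [mm_cons, map_mul, ← mul_assoc, one_smul]
      unfold yv at this
      rw [← this]
    · rcases v with v | v
      · refine ⟨1, fun φ hφ => ?_⟩
        have := even_comm (hφ.1 v) (φ (FreeAlgebra.ι F (Sum.inr u)))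
        simp only [mm_cons, map_mul, ← mul_assoc, one_smul]
        unfold yv at this
        rw [this]
      · refine ⟨-1, fun φ hφ => ?_⟩
        have := odd_anti (hφ.2 v) (hφ.2 u)
        simp only [mm_cons, map_mul, ← mul_assoc, neg_smul, one_smul]
        unfold zv at this
        rw [this, neg_mul]
  | trans _ _ ih1 ih2 =>
    obtain ⟨c, hc⟩ := ih1
    obtain ⟨d, hd⟩ := ih2
    exact ⟨c * d, fun φ hφ => by rw [hc φ hφ, hd φ hφ, smul_smul]⟩

lemma mm_inv {φ : FA F →ₐ[F] ExteriorAlgebra F M} (hφ : GS F M φ) (l : List (ℕ ⊕ ℕ)) :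
    grassInvol F M (φ (mm F l)) = (-1 : F) ^ (l.countP Sum.isRight) • φ (mm F l) := by
  induction l with
  | nil => simp [mm]
  | cons v l ih =>
    rw [mm_cons, map_mul, map_mul, ih]
    rcases v with v | v
    · have := mem_even.1 (hφ.1 v)
      unfold yv at this
      rw [this]; simp
    · have := mem_odd.1 (hφ.2 v)
      unfold zv at this
      rw [this, List.countP_cons_of_pos (by rfl)]; simp [pow_succ]

lemma mm_fil [CharZero F] {φ : FA F →ₐ[F] ExteriorAlgebra F M} (hφ : GS F M φ)
    (l : List (ℕ ⊕ ℕ)) : φ (mm F l) ∈ Rg F M ^ (l.countP Sum.isRight) * ⊤ := by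
  induction l with
  | nil => simp [mm]
  | cons v l ih =>
    rw [mm_cons, map_mul]
    rcases v with v | v
    · simpa using any_mul_fil _ _ ih
    · rw [List.countP_cons_of_pos (by rfl)]
      exact odd_mul_fil (hφ.2 v) _ ih

lemma count_mkv {n : ℕ} (s : Finset (Fin n)) :
    ((List.finRange n).map (mkv s)).countP Sum.isRight = s.card := by
  rw [List.countP_map, List.countP_eq_length_filter,
    ← List.toFinset_card_of_nodup ((List.nodup_finRange n).filter _)]
  congr 1
  ext i
  by_cases h : i ∈ s <;> simp [mkv, h]

lemma mono_zero [CharZero F] {t n : ℕ} {φ : FA F →ₐ[F] ExteriorAlgebra F (Fin t → F)}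
    (hφ : GS F _ φ) (s : Finset (Fin n)) (h : t < s.card) : φ (mono F s) = 0 := by
  have := mm_fil hφ ((List.finRange n).map (mkv s))
  rw [count_mkv, fil_zero h] at this
  simpa [mono] using this

lemma mono_mul_odd [CharZero F] {t n : ℕ} {φ : FA F →ₐ[F] ExteriorAlgebra F (Fin t → F)}
    (hφ : GS F _ φ) (s : Finset (Fin n)) (h : t ≤ s.card)
    {a : ExteriorAlgebra F (Fin t → F)} (ha : a ∈ grOdd F (Fin t → F)) :
    a * φ (mono F s) = 0 := by
  have := odd_mul_fil ha _ (mm_fil hφ ((List.finRange n).map (mkv s)))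
  rw [count_mkv, fil_zero (Nat.lt_succ_of_le h)] at this
  simpa [mono] using this

lemma mono_comm [CharZero F] {t n : ℕ} {φ : FA F →ₐ[F] ExteriorAlgebra F (Fin t → F)}
    (hφ : GS F _ φ) (s : Finset (Fin n)) (h : ¬ (s.card % 2 = 1 ∧ s.card < t))
    (x : ExteriorAlgebra F (Fin t → F)) : φ (mono F s) * x = x * φ (mono F s) := by
  have hinv := mm_inv hφ ((List.finRange n).map (mkv s))
  rw [count_mkv] at hinv
  change grassInvol F _ (φ (mono F s)) = _ • φ (mono F s) at hinv
  by_cases he : s.card % 2 = 1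
  · rw [(Nat.odd_iff.2 he).neg_one_pow, neg_smul, one_smul] at hinv
    have ht : t ≤ s.card := by
      by_contra h'
      exact h ⟨he, by omega⟩
    refine comm_of_ι (fun m => ?_) x
    have h0 := mono_mul_odd hφ s ht (ι_mem_odd m)
    rw [odd_anti (mem_odd.2 hinv) (ι_mem_odd m), h0, neg_zero]
  · rw [(Nat.even_iff.2 (by omega)).neg_one_pow, one_smul] at hinv
    exact even_comm (mem_even.2 hinv) x

lemma const_mm {l : List (ℕ ⊕ ℕ)} (h : l ≠ []) : constTerm F (mm F l) = 0 := by
  cases l with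
  | nil => exact absurd rfl h
  | cons v l => rw [mm_cons, map_mul]; simp [constTerm]

lemma gen_eq {n : ℕ} (σ : Equiv.Perm (Fin n)) (w : Fin n → Bool) :
    (List.ofFn fun i : Fin n =>
        if w (σ i) then zv F (σ i).val else yv F (σ i).val).prod =
      mm F (List.ofFn (mkv (Finset.univ.filter fun i => w i = true) ∘ σ)) := by
  rw [mm, List.map_ofFn]
  congr 2
  funext i
  by_cases h : w (σ i) <;> simp [mkv, h, zv, yv]

lemma const_Pn {n : ℕ} (hn : 1 ≤ n) {f : FA F} (hf : f ∈ PnGr F n) : constTerm F f = 0 := by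
  have : PnGr F n ≤ LinearMap.ker (constTerm F).toLinearMap := by
    unfold PnGr
    rw [Submodule.span_le]
    rintro _ ⟨σ, w, rfl⟩
    rw [gen_eq]
    refine const_mm ?_
    intro h
    have := congrArg List.length h
    simp at this
    omega
  exact this hf

lemma mono_mem {n : ℕ} (s : Finset (Fin n)) : mono F s ∈ PnGr F n := by
  refine Submodule.subset_span ⟨1, fun i => decide (i ∈ s), ?_⟩
  refine Eq.trans ?_ (gen_eq (F := F) 1 (fun i => decide (i ∈ s))).symm
  simp [mono, List.ofFn_eq_map]

lemma Pn_span (M : Type) [AddCommGroup M] [Module F M] {n : ℕ} {f : FA F} (hf : f ∈ PnGr F n) :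
    ∃ a : Finset (Fin n) → F, f - ∑ s, a s • mono F s ∈
      IdGr F (ExteriorAlgebra F M) (grEven F M) (grOdd F M) := by
  unfold PnGr at hf
  induction hf using Submodule.span_induction with
  | mem x hx =>
    obtain ⟨σ, w, rfl⟩ := hx
    rw [gen_eq]
    set s : Finset (Fin n) := Finset.univ.filter fun i => w i = true
    obtain ⟨c, hc⟩ := perm_sign (F := F) (M := M) (σ.ofFn_comp_perm (mkv s))
    refine ⟨Pi.single s c, fun φ hφ => ?_⟩
    rw [map_sub, hc φ hφ, Finset.sum_eq_single s, Pi.single_eq_same, map_smul]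
    · simp [mono, List.ofFn_eq_map]
    · intro b _ hb
      simp [Pi.single_eq_of_ne hb]
    · simp
  | zero => exact ⟨0, by simp⟩
  | add x y _ _ hx hy =>
    obtain ⟨a, ha⟩ := hx
    obtain ⟨b, hb⟩ := hy
    refine ⟨a + b, ?_⟩
    convert Submodule.add_mem _ ha hb using 1
    simp only [Pi.add_apply, add_smul, Finset.sum_add_distrib]
    abel
  | smul c x _ hx =>
    obtain ⟨a, ha⟩ := hx
    refine ⟨c • a, ?_⟩
    convert Submodule.smul_mem _ c ha using 1
    simp only [Pi.smul_apply, smul_eq_mul, mul_smul, smul_sub, Finset.smul_sum]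

lemma nodup_ne {t : ℕ} {L : List (Fin t)} (hL : L.Nodup) : (L.map (e F)).prod ≠ 0 := by
  intro h0
  have hp : (L ++ (List.finRange t).filter (fun i => i ∉ L)).Perm (List.finRange t) := by
    rw [List.perm_ext_iff_of_nodup _ (List.nodup_finRange t)]
    · intro a; by_cases h : a ∈ L <;> simp [h]
    · refine hL.append ((List.nodup_finRange t).filter _) ?_
      intro a ha hb
      simp at hb
      exact hb ha
  let φ : FA F →ₐ[F] ExteriorAlgebra F (Fin t → F) :=
    FreeAlgebra.lift F (Sum.elim (fun _ => 0) (fun j => if h : j < t then e F ⟨j, h⟩ else 0))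
  have hφ : GS F _ φ := by
    refine ⟨fun i => ?_, fun j => ?_⟩
    · simp [φ, yv]
    · simp only [φ, zv, FreeAlgebra.lift_ι_apply, Sum.elim_inr]
      split_ifs
      · exact ι_mem_odd _
      · exact Submodule.zero_mem _
  have hev : ∀ l : List (Fin t), φ (mm F (l.map fun i => Sum.inr i.val)) = (l.map (e F)).prod := by
    intro l
    induction l with
    | nil => simp [mm]
    | cons v l ih =>
      rw [List.map_cons, mm_cons, map_mul, ih]
      simp [φ]
  obtain ⟨c, hc⟩ := perm_sign (F := F) (M := Fin t → F)
    ((hp.map (fun i : Fin t => (Sum.inr i.val : ℕ ⊕ ℕ))).symm)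
  have := hc φ hφ
  rw [hev, hev, List.map_append, List.prod_append, h0, zero_mul, smul_zero] at this
  exact top_prod_ne this

lemma sel {n t : ℕ} (s : Finset (Fin n)) (hs : s.card ≤ t) :
    ∃ (φ : FA F →ₐ[F] ExteriorAlgebra F (Fin t → F)) (L : List (Fin t)), GS F _ φ ∧
      L.Nodup ∧ L.length = s.card ∧ φ (mono F s) = (L.map (e F)).prod ∧
      ∀ s' : Finset (Fin n), s' ≠ s → φ (mono F s') = 0 := by
  obtain ⟨j⟩ : Nonempty (s ↪ Fin t) := by
    apply Function.Embedding.nonempty_of_card_le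
    simpa using hs
  let φ : FA F →ₐ[F] ExteriorAlgebra F (Fin t → F) :=
    FreeAlgebra.lift F (Sum.elim
      (fun i => if ∃ h : i < n, (⟨i, h⟩ : Fin n) ∈ s then 0 else 1)
      (fun i => if h : ∃ h : i < n, (⟨i, h⟩ : Fin n) ∈ s then e F (j ⟨⟨i, h.1⟩, h.2⟩) else 0))
  have hφ : GS F _ φ := by
    refine ⟨fun i => ?_, fun i => ?_⟩
    · simp only [φ, yv, FreeAlgebra.lift_ι_apply, Sum.elim_inl]
      split_ifs
      · exact Submodule.zero_mem _
      · exact mem_even.2 (map_one _)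
    · simp only [φ, zv, FreeAlgebra.lift_ι_apply, Sum.elim_inr]
      split_ifs
      · exact ι_mem_odd _
      · exact Submodule.zero_mem _
  have key : ∀ l : List (Fin n), l.Nodup → ∃ L : List (Fin t), L.Nodup ∧
      L.length = l.countP (· ∈ s) ∧ φ (mm F (l.map (mkv s))) = (L.map (e F)).prod ∧
      ∀ x ∈ L, ∃ (i : Fin n) (h : i ∈ s), i ∈ l ∧ x = j ⟨i, h⟩ := by
    intro l
    induction l with
    | nil => intro _; exact ⟨[], by simp [mm]⟩
    | cons v l ih =>
      intro hl
      rw [List.nodup_cons] at hl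
      obtain ⟨L, h1, h2, h3, h4⟩ := ih hl.2
      by_cases hv : v ∈ s
      · refine ⟨j ⟨v, hv⟩ :: L, ?_, ?_, ?_, ?_⟩
        · rw [List.nodup_cons]
          refine ⟨fun hm => ?_, h1⟩
          obtain ⟨i, hi, hil, he⟩ := h4 _ hm
          have := j.injective he
          simp only [Subtype.mk.injEq] at this
          exact hl.1 (this ▸ hil)
        · simp [hv, h2]
        · rw [List.map_cons, mm_cons, map_mul, h3]
          simp [φ, mkv, hv]
        · intro x hx
          rcases List.mem_cons.1 hx with rfl | hx
          · exact ⟨v, hv, by simp, rfl⟩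
          · obtain ⟨i, hi, hil, he⟩ := h4 _ hx
            exact ⟨i, hi, by simp [hil], he⟩
      · refine ⟨L, h1, ?_, ?_, ?_⟩
        · simp [hv, h2]
        · rw [List.map_cons, mm_cons, map_mul, h3]
          simp [φ, mkv, hv]
        · intro x hx
          obtain ⟨i, hi, hil, he⟩ := h4 _ hx
          exact ⟨i, hi, by simp [hil], he⟩
  obtain ⟨L, h1, h2, h3, -⟩ := key _ (List.nodup_finRange n)
  refine ⟨φ, L, hφ, h1, ?_, h3, ?_⟩
  · rw [h2, ← count_mkv s, List.countP_map]
    congr 1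
    funext i
    by_cases h : i ∈ s <;> simp [mkv, h]
  · intro s' hs'
    obtain ⟨i, hi⟩ : ∃ i, ¬ (i ∈ s' ↔ i ∈ s) := by
      by_contra hcon
      push Not at hcon
      exact hs' (Finset.ext hcon)
    rw [mono, mm, map_list_prod]
    apply List.prod_eq_zero
    simp only [List.map_map, List.mem_map, List.mem_finRange, true_and]
    refine ⟨i, ?_⟩
    by_cases h' : i ∈ s' <;> by_cases h : i ∈ s <;> simp [φ, mkv, h, h'] at hi ⊢

lemma sel_sum {n t : ℕ} {φ : FA F →ₐ[F] ExteriorAlgebra F (Fin t → F)} {s : Finset (Fin n)}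
    (h : ∀ s' : Finset (Fin n), s' ≠ s → φ (mono F s') = 0) (a : Finset (Fin n) → F) :
    φ (∑ s, a s • mono F s) = a s • φ (mono F s) := by
  rw [map_sum, Finset.sum_eq_single s]
  · simp
  · intro b _ hb; simp [h b hb]
  · simp

lemma indep_I {n t : ℕ} (a : Finset (Fin n) → F)
    (h : ∑ s, a s • mono F s ∈ IdGr F (ExteriorAlgebra F (Fin t → F))
      (grEven F (Fin t → F)) (grOdd F (Fin t → F)))
    (s : Finset (Fin n)) (hs : s.card ≤ t) : a s = 0 := by
  obtain ⟨φ, L, hφ, hL, -, hm, h0⟩ := sel (F := F) s hs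
  have := h φ hφ
  rw [sel_sum h0, hm, smul_eq_zero] at this
  exact this.resolve_right (nodup_ne hL)

lemma indep_C [CharZero F] {n t : ℕ} (a : Finset (Fin n) → F)
    (h : ∑ s, a s • mono F s ∈ CGr F (ExteriorAlgebra F (Fin t → F))
      (grEven F (Fin t → F)) (grOdd F (Fin t → F)))
    (s : Finset (Fin n)) (hs : s.card % 2 = 1 ∧ s.card < t) : a s = 0 := by
  obtain ⟨φ, L, hφ, hL, hlen, hm, h0⟩ := sel (F := F) s hs.2.le
  have := (h.2 φ hφ).2
  rw [sel_sum h0] at this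
  obtain ⟨i, hi⟩ : ∃ i : Fin t, i ∉ L := by
    by_contra hcon
    push Not at hcon
    have h1 := List.toFinset_card_le L
    have h2 : L.toFinset = Finset.univ := by ext i; simp [hcon]
    rw [h2] at h1
    simp at h1
    omega
  have hodd : φ (mono F s) ∈ grOdd F (Fin t → F) := by
    have hinv := mm_inv hφ ((List.finRange n).map (mkv s))
    rw [count_mkv, (Nat.odd_iff.2 hs.1).neg_one_pow, neg_smul, one_smul] at hinv
    exact mem_odd.2 hinv
  have h3 := this (e F i) (Submodule.mem_sup_right (ι_mem_odd _))
  rw [smul_mul_assoc, mul_smul_comm, odd_anti (ι_mem_odd _) hodd, smul_neg,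
    ← add_eq_zero_iff_eq_neg, ← two_smul F, smul_eq_zero_iff_right (two_ne_zero' F),
    smul_eq_zero] at h3
  refine h3.resolve_right ?_
  rw [hm]
  have := nodup_ne (F := F) (L := L ++ [i]) (by
    rw [List.nodup_append]
    exact ⟨hL, by simp, by rintro a ha b hb rfl; simp at hb; exact hi (hb ▸ ha)⟩)
  simpa using this

end Mono

section Dim

variable {F V κ : Type} [Field F] [AddCommGroup V] [Module F V] [Fintype κ]

lemma ext_sum (S : κ → Prop) [DecidablePred S] (m : κ → V) (a : {i // S i} → F) :
    ∑ i : {i // S i}, a i • m i = ∑ i, (if h : S i then a ⟨i, h⟩ else 0) • m i := by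
  rw [← Fintype.sum_subtype_add_sum_subtype S
    (fun i => (if h : S i then a ⟨i, h⟩ else 0) • m i)]
  rw [Finset.sum_eq_zero (s := (Finset.univ : Finset {i // ¬ S i})), add_zero]
  · exact Finset.sum_congr rfl fun i _ => by simp [i.2]
  · intro i _
    simp [i.2]

/-- dimension of a quotient `Q / (Q ∩ D)` from a family that is a basis modulo `D` -/
lemma quot_dim (Q D : Submodule F V) (S : κ → Prop) [DecidablePred S] (m : κ → V) (hm : ∀ i, S i → m i ∈ Q)
    (hspan : ∀ f ∈ Q, ∃ a : κ → F, f - ∑ i, (if S i then a i else 0) • m i ∈ D)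
    (hind : ∀ a : κ → F, (∀ i, ¬ S i → a i = 0) → ∑ i, a i • m i ∈ D → ∀ i, S i → a i = 0) :
    Module.finrank F (↥Q ⧸ Submodule.comap Q.subtype D) = (Finset.univ.filter S).card := by
  let g : ({i // S i} → F) →ₗ[F] (↥Q ⧸ Submodule.comap Q.subtype D) :=
    (Submodule.mkQ _).comp (Fintype.linearCombination F (fun i : {i // S i} => (⟨m i, hm i i.2⟩ : Q)))
  have hg : ∀ a, Q.subtype (Fintype.linearCombination F
      (fun i : {i // S i} => (⟨m i, hm i i.2⟩ : Q)) a)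
      = ∑ i, (if h : S i then a ⟨i, h⟩ else 0) • m i := by
    intro a
    rw [← ext_sum, Fintype.linearCombination_apply, map_sum]
    simp
  have hb : Function.Bijective g := by
    constructor
    · rw [injective_iff_map_eq_zero]
      intro a ha
      have ha' : Fintype.linearCombination F
        (fun i : {i // S i} => (⟨m i, hm i i.2⟩ : Q)) a ∈ Submodule.comap Q.subtype D :=
        (Submodule.Quotient.mk_eq_zero _).1 ha
      rw [Submodule.mem_comap, hg] at ha'
      funext i
      have := hind _ (fun i hi => by simp [hi]) ha' i i.2
      simpa [i.2] using this
    · intro q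
      obtain ⟨f, rfl⟩ := Submodule.mkQ_surjective _ q
      obtain ⟨a, ha⟩ := hspan f f.2
      refine ⟨fun i => a i, ?_⟩
      symm
      refine (Submodule.Quotient.eq _).2 ?_
      rw [Submodule.mem_comap, map_sub, hg]
      simpa using ha
  rw [← (LinearEquiv.ofBijective g hb).finrank_eq, Module.finrank_fintype_fun_eq_card,
    Fintype.card_subtype]

lemma two_dims (P C I : Submodule F V) (hIC : ∀ f ∈ P, f ∈ I → f ∈ C)
    (S N : κ → Prop) [DecidablePred S] [DecidablePred N] (hSN : ∀ i, S i → N i) (m : κ → V)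
    (hm : ∀ i, m i ∈ P) (hspan : ∀ f ∈ P, ∃ a : κ → F, f - ∑ i, a i • m i ∈ I)
    (hC : ∀ i, ¬ S i → m i ∈ C) (hI : ∀ i, ¬ N i → m i ∈ I)
    (iC : ∀ a : κ → F, ∑ i, a i • m i ∈ C → ∀ i, S i → a i = 0)
    (iI : ∀ a : κ → F, ∑ i, a i • m i ∈ I → ∀ i, N i → a i = 0) :
    Module.finrank F (↥P ⧸ Submodule.comap P.subtype C) = (Finset.univ.filter S).card ∧
    Module.finrank F (↥(P ⊓ C) ⧸ Submodule.comap (P ⊓ C).subtype (P ⊓ I)) =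
      (Finset.univ.filter fun i => N i ∧ ¬ S i).card := by
  have hsum : ∀ a : κ → F, ∑ i, a i • m i ∈ P := fun a =>
    Submodule.sum_mem _ fun i _ => P.smul_mem _ (hm i)
  have hspanC : ∀ f ∈ P, ∃ a : κ → F, f - ∑ i, a i • m i ∈ C ∧ f - ∑ i, a i • m i ∈ I := by
    intro f hf
    obtain ⟨a, ha⟩ := hspan f hf
    exact ⟨a, hIC _ (P.sub_mem hf (hsum a)) ha, ha⟩
  constructor
  · refine quot_dim P C S m (fun i _ => hm i) ?_ (fun a _ h => iC a h)
    intro f hf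
    obtain ⟨a, ha, -⟩ := hspanC f hf
    refine ⟨a, ?_⟩
    have e : f - ∑ i, (if S i then a i else 0) • m i =
        (f - ∑ i, a i • m i) + ∑ i, (if S i then 0 else a i) • m i := by
      rw [sub_add, ← Finset.sum_sub_distrib]
      congr 1
      refine Finset.sum_congr rfl fun i _ => ?_
      split_ifs <;> simp
    rw [e]
    refine C.add_mem ha (Submodule.sum_mem _ fun i _ => ?_)
    split_ifs with h
    · simp
    · exact C.smul_mem _ (hC i h)
  · refine quot_dim (P ⊓ C) (P ⊓ I) (fun i => N i ∧ ¬ S i) m (fun i h => ⟨hm i, hC i h.2⟩) ?_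
      (fun a _ h i hi => iI a h.2 i hi.1)
    intro f hf
    obtain ⟨a, haC, haI⟩ := hspanC f hf.1
    have hz := iC a (by
      have := C.sub_mem hf.2 haC
      rwa [sub_sub_cancel] at this)
    refine ⟨a, P.sub_mem hf.1 (hsum _), ?_⟩
    have e : f - ∑ i, (if N i ∧ ¬ S i then a i else 0) • m i =
        (f - ∑ i, a i • m i) + ∑ i, (if N i then 0 else a i) • m i := by
      rw [sub_add, ← Finset.sum_sub_distrib]
      congr 1
      refine Finset.sum_congr rfl fun i _ => ?_
      by_cases hS : S i
      · simp [hS, hSN i hS, hz i hS]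
      · by_cases hN : N i <;> simp [hS, hN]
    rw [e]
    refine I.add_mem haI (Submodule.sum_mem _ fun i _ => ?_)
    split_ifs with h
    · simp
    · exact I.smul_mem _ (hI i h)

end Dim

lemma count_card (n : ℕ) (A : Finset ℕ) (p : Finset (Fin n) → Prop) [DecidablePred p]
    (h : ∀ s, p s ↔ s.card ∈ A) :
    (Finset.univ.filter p).card = ∑ i ∈ A, n.choose i := by
  rw [Finset.card_eq_sum_card_fiberwise (f := Finset.card) (t := A)]
  · refine Finset.sum_congr rfl fun i hi => ?_
    have : (Finset.univ.filter p).filter (fun s => s.card = i) =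
        Finset.powersetCard i (Finset.univ : Finset (Fin n)) := by
      ext s
      simp only [Finset.mem_filter, Finset.mem_univ, true_and, Finset.mem_powersetCard,
        Finset.subset_univ, h]
      exact ⟨fun h => h.2, fun h => ⟨h ▸ hi, h⟩⟩
    rw [this, Finset.card_powersetCard, Finset.card_univ, Fintype.card_fin]
  · intro s hs
    exact (h s).1 (by simpa using hs)

lemma main (F : Type) [Field F] [CharZero F] (t n : ℕ) (hn : 1 ≤ n) :
    scodim F (PnGr F n)
        (CGr F (ExteriorAlgebra F (Fin t → F)) (grEven F (Fin t → F)) (grOdd F (Fin t → F))) =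
      (Finset.univ.filter fun s : Finset (Fin n) => s.card % 2 = 1 ∧ s.card < t).card ∧
    deltaDim F (PnGr F n)
        (CGr F (ExteriorAlgebra F (Fin t → F)) (grEven F (Fin t → F)) (grOdd F (Fin t → F)))
        (IdGr F (ExteriorAlgebra F (Fin t → F)) (grEven F (Fin t → F)) (grOdd F (Fin t → F))) =
      (Finset.univ.filter fun s : Finset (Fin n) =>
        s.card ≤ t ∧ ¬ (s.card % 2 = 1 ∧ s.card < t)).card := by
  refine two_dims _ _ _ ?_ (fun s : Finset (Fin n) => s.card % 2 = 1 ∧ s.card < t)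
    (fun s => s.card ≤ t) (fun s h => h.2.le) (fun s => mono F s) mono_mem
    (fun f hf => Pn_span _ hf) ?_ ?_ indep_C indep_I
  · intro f hf hI
    refine ⟨const_Pn hn hf, fun φ hφ => ?_⟩
    rw [hI φ hφ]
    exact Submodule.zero_mem _
  · intro s hs
    refine ⟨const_Pn hn (mono_mem s), fun φ hφ => ⟨?_, fun y _ => mono_comm hφ s hs y⟩⟩
    rw [sup_top]
    trivial
  · intro s hs φ hφ
    exact mono_zero hφ s (by omega)

end GrAux

/-- for `k ≥ 1`, `n ≥ 1`:
`c_n^{gr,z}(G_{2k}^{gr}) = c_n^{gr,z}(G_{2k+1}^{gr}) = Σ_{i odd, 1≤i≤2k-1} C(n,i)`,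
`δ_n^{gr}(G_{2k}^{gr}) = Σ_{i even, 0≤i≤2k} C(n,i)`, and
`δ_n^{gr}(G_{2k+1}^{gr}) = C(n,2k+1) + Σ_{i even, 0≤i≤2k} C(n,i)`. -/
theorem stmt16 (F : Type) [Field F] [CharZero F] (k n : ℕ) (hk : 1 ≤ k) (hn : 1 ≤ n) :
    scodim F (PnGr F n)
        (CGr F (ExteriorAlgebra F (Fin (2 * k) → F))
          (grEven F (Fin (2 * k) → F)) (grOdd F (Fin (2 * k) → F))) =
      ∑ i ∈ (Finset.range (2 * k)).filter (fun i => i % 2 = 1), Nat.choose n i ∧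
    scodim F (PnGr F n)
        (CGr F (ExteriorAlgebra F (Fin (2 * k + 1) → F))
          (grEven F (Fin (2 * k + 1) → F)) (grOdd F (Fin (2 * k + 1) → F))) =
      ∑ i ∈ (Finset.range (2 * k)).filter (fun i => i % 2 = 1), Nat.choose n i ∧
    deltaDim F (PnGr F n)
        (CGr F (ExteriorAlgebra F (Fin (2 * k) → F))
          (grEven F (Fin (2 * k) → F)) (grOdd F (Fin (2 * k) → F)))
        (IdGr F (ExteriorAlgebra F (Fin (2 * k) → F))
          (grEven F (Fin (2 * k) → F)) (grOdd F (Fin (2 * k) → F))) =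
      ∑ i ∈ (Finset.range (2 * k + 1)).filter (fun i => i % 2 = 0), Nat.choose n i ∧
    deltaDim F (PnGr F n)
        (CGr F (ExteriorAlgebra F (Fin (2 * k + 1) → F))
          (grEven F (Fin (2 * k + 1) → F)) (grOdd F (Fin (2 * k + 1) → F)))
        (IdGr F (ExteriorAlgebra F (Fin (2 * k + 1) → F))
          (grEven F (Fin (2 * k + 1) → F)) (grOdd F (Fin (2 * k + 1) → F))) =
      Nat.choose n (2 * k + 1) +
        ∑ i ∈ (Finset.range (2 * k + 1)).filter (fun i => i % 2 = 0), Nat.choose n i := by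
  classical
  obtain ⟨a1, a2⟩ := GrAux.main F (2 * k) n hn
  obtain ⟨b1, b2⟩ := GrAux.main F (2 * k + 1) n hn
  rw [a1, a2, b1, b2]
  refine ⟨?_, ?_, ?_, ?_⟩
  · refine GrAux.count_card n _ _ fun s => ?_
    simp only [Finset.mem_filter, Finset.mem_range]; omega
  · refine GrAux.count_card n _ _ fun s => ?_
    simp only [Finset.mem_filter, Finset.mem_range]; omega
  · refine GrAux.count_card n _ _ fun s => ?_
    simp only [Finset.mem_filter, Finset.mem_range]; omega
  · rw [← Finset.sum_insert (a := 2 * k + 1) (f := fun i => n.choose i)]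
    · refine GrAux.count_card n _ _ fun s => ?_
      simp only [Finset.mem_insert, Finset.mem_filter, Finset.mem_range]; omega
    · simp
end

section
/- For every n ≥ 1, the infinite-dimensional Grassmann algebra with its canonical grading G^{gr} satisfies c_n^{gr,z}(G^{gr}) = 2^{n−1} and δ_n^{gr}(G^{gr}) = 2^{n−1}. -/
namespace Stmt17

section
variable {F : Type} [Field F]

abbrev GA (F : Type) [Field F] : Type := ExteriorAlgebra F (ℕ →₀ F)

/-- generator -/
noncomputable def gen (F : Type) [Field F] (i : ℕ) : GA F :=
  ExteriorAlgebra.ι F (Finsupp.single i (1 : F))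

lemma invol_ι (m : ℕ →₀ F) :
    grassInvol F (ℕ →₀ F) (ExteriorAlgebra.ι F m) = - ExteriorAlgebra.ι F m := by
  simp [grassInvol]

lemma mem_even {x : GA F} : x ∈ grEven F (ℕ →₀ F) ↔ grassInvol F (ℕ →₀ F) x = x := by
  simp [grEven, sub_eq_zero]

lemma mem_odd {x : GA F} : x ∈ grOdd F (ℕ →₀ F) ↔ grassInvol F (ℕ →₀ F) x = -x := by
  simp [grOdd, add_eq_zero_iff_eq_neg]

lemma ι_mul (m : ℕ →₀ F) (x : GA F) :
    ExteriorAlgebra.ι F m * x = grassInvol F (ℕ →₀ F) x * ExteriorAlgebra.ι F m := by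
  induction x using ExteriorAlgebra.induction with
  | algebraMap r => rw [AlgHom.commutes]; exact (Algebra.commutes r _).symm
  | ι y =>
    rw [invol_ι, neg_mul]
    exact eq_neg_of_add_eq_zero_left (ExteriorAlgebra.ι_add_mul_swap m y)
  | mul a b ha hb => rw [← mul_assoc, ha, mul_assoc, hb, map_mul, mul_assoc]
  | add a b ha hb => rw [mul_add, ha, hb, map_add, add_mul]

lemma even_comm {x : GA F} (hx : x ∈ grEven F (ℕ →₀ F)) (y : GA F) : y * x = x * y := by
  rw [mem_even] at hx
  induction y using ExteriorAlgebra.induction with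
  | algebraMap r => exact (Algebra.commutes r _)
  | ι y => rw [ι_mul, hx]
  | mul a b ha hb => rw [mul_assoc, hb, ← mul_assoc, ha, mul_assoc]
  | add a b ha hb => rw [mul_add, ← ha, ← hb, add_mul]

lemma odd_comm {x : GA F} (hx : x ∈ grOdd F (ℕ →₀ F)) (y : GA F) :
    y * x = x * grassInvol F (ℕ →₀ F) y := by
  rw [mem_odd] at hx
  induction y using ExteriorAlgebra.induction with
  | algebraMap r => rw [AlgHom.commutes]; exact (Algebra.commutes r _)
  | ι y => rw [ι_mul, hx, invol_ι]; simp
  | mul a b ha hb => rw [mul_assoc, hb, ← mul_assoc, ha, mul_assoc, map_mul]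
  | add a b ha hb => rw [map_add, mul_add, ← ha, ← hb, add_mul]

lemma contract_prod (i : ℕ) (l : List ℕ) (hi : i ∉ l) :
    CliffordAlgebra.contractLeft (Q := (0 : QuadraticForm F (ℕ →₀ F)))
      (Finsupp.lapply i : (ℕ →₀ F) →ₗ[F] F) ((l.map (gen F)).prod) = 0 := by
  induction l with
  | nil => simp
  | cons a l ih =>
    simp only [List.mem_cons, not_or] at hi
    rw [List.map_cons, List.prod_cons, gen, ExteriorAlgebra.ι,
      CliffordAlgebra.contractLeft_ι_mul, ih hi.2]
    simp [Finsupp.single_apply, Ne.symm hi.1]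

lemma prod_ne (l : List ℕ) (hl : l.Nodup) : (l.map (gen F)).prod ≠ 0 := by
  induction l with
  | nil => simp
  | cons a l ih =>
    rw [List.nodup_cons] at hl
    intro h
    apply ih hl.2
    have := congrArg (CliffordAlgebra.contractLeft (Q := (0 : QuadraticForm F (ℕ →₀ F)))
      (Finsupp.lapply a : (ℕ →₀ F) →ₗ[F] F)) h
    rw [List.map_cons, List.prod_cons, gen, ExteriorAlgebra.ι,
      CliffordAlgebra.contractLeft_ι_mul, contract_prod a l hl.1] at this
    simpa using this

lemma prod_filter (p : ℕ → Bool) (l : List ℕ) :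
    (l.map (fun i => if p i then gen F i else 1)).prod = ((l.filter p).map (gen F)).prod := by
  induction l with
  | nil => simp
  | cons a l ih => by_cases h : p a <;> simp [h, ih]

/-- monomial -/
noncomputable def mono (F : Type) [Field F] (l : List (ℕ ⊕ ℕ)) : FA F :=
  (l.map (FreeAlgebra.ι F)).prod

abbrev GS (φ : FA F →ₐ[F] GA F) : Prop :=
  IsGSubst F (GA F) (grEven F (ℕ →₀ F)) (grOdd F (ℕ →₀ F)) φ

lemma perm_mono {l₁ l₂ : List (ℕ ⊕ ℕ)} (h : l₁.Perm l₂) :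
    ∃ s : F, ∀ φ : FA F →ₐ[F] GA F, GS φ → φ (mono F l₁) = s • φ (mono F l₂) := by
  induction h with
  | nil => exact ⟨1, fun φ _ => by simp⟩
  | cons x _ ih =>
    obtain ⟨s, hs⟩ := ih
    refine ⟨s, fun φ hφ => ?_⟩
    have := hs φ hφ
    simp only [mono, List.map_cons, List.prod_cons, map_mul] at this ⊢
    rw [this, mul_smul_comm]
  | swap x y l =>
    have key : ∃ s : F, ∀ φ : FA F →ₐ[F] GA F, GS φ →
        φ (FreeAlgebra.ι F y) * φ (FreeAlgebra.ι F x) =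
          s • (φ (FreeAlgebra.ι F x) * φ (FreeAlgebra.ι F y)) := by
      rcases x with x | x
      · exact ⟨1, fun φ hφ => by rw [one_smul]; exact even_comm (hφ.1 x) _⟩
      · rcases y with y | y
        · exact ⟨1, fun φ hφ => by rw [one_smul]; exact (even_comm (hφ.1 y) _).symm⟩
        · refine ⟨-1, fun φ hφ => ?_⟩
          have h1 := hφ.2 x
          have h2 := mem_odd.1 (hφ.2 y)
          unfold zv at h1 h2
          rw [odd_comm h1, h2]; simp
    obtain ⟨s, hs⟩ := key
    refine ⟨s, fun φ hφ => ?_⟩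
    simp only [mono, List.map_cons, List.prod_cons, map_mul]
    rw [← mul_assoc, hs φ hφ, smul_mul_assoc, mul_assoc]
  | trans _ _ ih1 ih2 =>
    obtain ⟨s, hs⟩ := ih1
    obtain ⟨t, ht⟩ := ih2
    exact ⟨s * t, fun φ hφ => by rw [hs φ hφ, ht φ hφ, mul_smul]⟩

/-- sign of a variable -/
def vs (F : Type) [Field F] : ℕ ⊕ ℕ → F := Sum.elim (fun _ => 1) (fun _ => -1)

lemma invol_mono (φ : FA F →ₐ[F] GA F) (hφ : GS φ) (l : List (ℕ ⊕ ℕ)) :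
    grassInvol F (ℕ →₀ F) (φ (mono F l)) = (l.map (vs F)).prod • φ (mono F l) := by
  induction l with
  | nil => simp [mono]
  | cons a l ih =>
    simp only [mono, List.map_cons, List.prod_cons, map_mul] at ih ⊢
    rw [ih]
    rcases a with a | a
    · have := mem_even.1 (hφ.1 a)
      unfold yv at this
      rw [this]; simp [vs]
    · have := mem_odd.1 (hφ.2 a)
      unfold zv at this
      rw [this]; simp [vs]

lemma const_mono (l : List (ℕ ⊕ ℕ)) (hl : l ≠ []) : constTerm F (mono F l) = 0 := by
  cases l with
  | nil => exact absurd rfl hl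
  | cons a l => simp [mono, constTerm]

variable {n : ℕ}

def var (w : Fin n → Bool) (i : Fin n) : ℕ ⊕ ℕ := if w i then Sum.inr i.val else Sum.inl i.val

def word (w : Fin n → Bool) : List (ℕ ⊕ ℕ) := List.ofFn (var w)

noncomputable def mw (F : Type) [Field F] (w : Fin n → Bool) : FA F := mono F (word w)

def sg (F : Type) [Field F] (w : Fin n → Bool) : F := ∏ i, (if w i then (-1 : F) else 1)

lemma sg_eq (w : Fin n → Bool) : ((word w).map (vs F)).prod = sg F w := by
  rw [word, List.map_ofFn, List.prod_ofFn, sg]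
  refine Finset.prod_congr rfl fun i _ => ?_
  by_cases h : w i <;> simp [var, h, vs]

lemma sg_cases (w : Fin n → Bool) : sg F w = 1 ∨ sg F w = -1 := by
  unfold sg
  induction (Finset.univ : Finset (Fin n)) using Finset.induction_on with
  | empty => simp
  | insert a s ha ih =>
    rw [Finset.prod_insert ha]
    rcases ih with h | h <;> rw [h] <;> by_cases h : w a <;> simp [h]

lemma gen_eq (σ : Equiv.Perm (Fin n)) (w : Fin n → Bool) :
    (List.ofFn fun i : Fin n =>
        if w (σ i) then zv F (σ i).val else yv F (σ i).val).prod
      = mono F (List.ofFn fun i => var w (σ i)) := by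
  rw [mono, List.map_ofFn]
  congr 2
  funext i
  by_cases h : w (σ i) <;> simp [var, h, zv, yv]

abbrev P (F : Type) [Field F] (n : ℕ) := PnGr F n
noncomputable abbrev C (F : Type) [Field F] := CGr F (ExteriorAlgebra F (ℕ →₀ F))
          (grEven F (ℕ →₀ F)) (grOdd F (ℕ →₀ F))
noncomputable abbrev I (F : Type) [Field F] := IdGr F (ExteriorAlgebra F (ℕ →₀ F))
          (grEven F (ℕ →₀ F)) (grOdd F (ℕ →₀ F))

lemma mw_mem (w : Fin n → Bool) : mw F w ∈ P F n :=
  Submodule.subset_span ⟨1, w, by rw [gen_eq]; rfl⟩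

lemma claimA (p : FA F) (hp : p ∈ P F n) :
    ∃ c : (Fin n → Bool) → F, p - ∑ w, c w • mw F w ∈ I F := by
  induction hp using Submodule.span_induction with
  | mem x hx =>
    obtain ⟨σ, w, rfl⟩ := hx
    rw [gen_eq]
    have hp : (List.ofFn fun i => var w (σ i)).Perm (word w) :=
      Equiv.Perm.ofFn_comp_perm σ (var w)
    obtain ⟨s, hs⟩ := perm_mono (F := F) hp
    refine ⟨Pi.single w s, fun φ hφ => ?_⟩
    rw [map_sub, hs φ hφ, map_sum, Finset.sum_eq_single w]
    · simp [mw]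
    · intro b _ hb; simp [Pi.single_apply, hb]
    · simp
  | zero => exact ⟨0, by simp⟩
  | add x y _ _ hx hy =>
    obtain ⟨c, hc⟩ := hx
    obtain ⟨d, hd⟩ := hy
    refine ⟨c + d, ?_⟩
    have := (I F).add_mem hc hd
    convert this using 1
    simp only [Pi.add_apply, add_smul, Finset.sum_add_distrib]
    abel
  | smul a x _ hx =>
    obtain ⟨c, hc⟩ := hx
    refine ⟨a • c, ?_⟩
    have := (I F).smul_mem a hc
    convert this using 1
    simp only [Pi.smul_apply, smul_sub, Finset.smul_sum, smul_smul, smul_eq_mul]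

lemma const_P (hn : 1 ≤ n) (p : FA F) (hp : p ∈ P F n) : constTerm F p = 0 := by
  induction hp using Submodule.span_induction with
  | mem x hx =>
    obtain ⟨σ, w, rfl⟩ := hx
    rw [gen_eq]
    apply const_mono
    intro h
    have := congrArg List.length h
    simp at this; omega
  | zero => simp
  | add x y _ _ hx hy => rw [map_add, hx, hy, add_zero]
  | smul a x _ hx => rw [map_smul, hx, smul_zero]

lemma PI_le_C (hn : 1 ≤ n) : P F n ⊓ I F ≤ C F := by
  rintro p ⟨hp, hI⟩
  refine ⟨const_P hn p hp, fun φ hφ => ?_⟩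
  rw [hI φ hφ]; exact Submodule.zero_mem _

lemma claimD (hn : 1 ≤ n) (w : Fin n → Bool) (hw : sg F w = 1) : mw F w ∈ C F := by
  refine ⟨const_P hn _ (mw_mem w), fun φ hφ => ?_⟩
  have h : φ (mw F w) ∈ grEven F (ℕ →₀ F) := by
    rw [mem_even, mw, invol_mono φ hφ, sg_eq, hw, one_smul]
  exact ⟨Submodule.mem_sup_left h, fun y _ => (even_comm h y).symm⟩

def ext (w : Fin n → Bool) (i : ℕ) : Bool := if h : i < n then w ⟨i, h⟩ else false

/-- test substitution -/
noncomputable def sub (F : Type) [Field F] (w : Fin n → Bool) : FA F →ₐ[F] GA F :=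
  FreeAlgebra.lift F (Sum.elim (fun i => if ext w i then 0 else 1)
    (fun i => if ext w i then gen F i else 0))

lemma sub_gs (w : Fin n → Bool) : GS (sub F w) := by
  constructor
  · intro i
    rw [mem_even]
    by_cases h : ext w i <;> simp [sub, yv, h]
  · intro i
    rw [mem_odd]
    by_cases h : ext w i <;> simp [sub, zv, h, gen, invol_ι]

lemma sub_ne (w v : Fin n → Bool) (h : v ≠ w) : sub F w (mw F v) = 0 := by
  obtain ⟨i, hi⟩ := Function.ne_iff.1 h
  rw [mw, mono, map_list_prod]
  apply List.prod_eq_zero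
  rw [word, List.map_ofFn, List.map_ofFn, List.mem_ofFn]
  refine ⟨i, ?_⟩
  have he : ext w i = w i := by simp [ext]
  cases h1 : w i <;> cases h2 : v i <;> simp_all [var, sub]

/-- support list -/
def supp (w : Fin n → Bool) : List ℕ := (List.ofFn fun i : Fin n => i.val).filter (ext w)

lemma sub_eq (w : Fin n → Bool) : sub F w (mw F w) = ((supp w).map (gen F)).prod := by
  rw [supp, ← prod_filter, mw, mono, map_list_prod, word, List.map_ofFn, List.map_ofFn,
    List.map_ofFn]
  congr 2
  funext i
  have he : ext w i = w i := by simp [ext]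
  cases h1 : w i <;> simp_all [var, sub]

lemma supp_nodup (w : Fin n → Bool) : (supp w ++ [n]).Nodup := by
  have : (supp w).Nodup := (List.nodup_ofFn.2 Fin.val_injective).filter _
  rw [List.nodup_append]
  refine ⟨this, by simp, ?_⟩
  intro a ha b hb
  simp only [supp, List.mem_filter, List.mem_ofFn] at ha
  obtain ⟨⟨i, rfl⟩, _⟩ := ha
  simp at hb
  have := i.isLt
  omega

lemma sub_sum (c : (Fin n → Bool) → F) (w : Fin n → Bool) :
    sub F w (∑ v, c v • mw F v) = c w • ((supp w).map (gen F)).prod := by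
  rw [map_sum, Finset.sum_eq_single w]
  · rw [map_smul, sub_eq]
  · intro b _ hb; rw [map_smul, sub_ne _ _ hb, smul_zero]
  · simp

lemma claimC (c : (Fin n → Bool) → F) (h : ∑ v, c v • mw F v ∈ I F) : c = 0 := by
  funext w
  have := h (sub F w) (sub_gs w)
  rw [sub_sum] at this
  exact (smul_eq_zero.1 this).resolve_right (prod_ne _ (supp_nodup w).of_append_left)

lemma claimB [CharZero F] (c : (Fin n → Bool) → F) (h : ∑ v, c v • mw F v ∈ C F)
    (w : Fin n → Bool) (hw : sg F w ≠ 1) : c w = 0 := by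
  have h1 := (h.2 (sub F w) (sub_gs w)).2 (gen F n)
    (Submodule.mem_sup_right (by rw [mem_odd, gen, invol_ι]))
  have hw' := (sg_cases (F := F) w).resolve_left hw
  have h2 := invol_mono (sub F w) (sub_gs w) (word w)
  rw [sg_eq, hw', ← mw, sub_eq] at h2
  rw [sub_sum] at h1
  have h3 : gen F n * ((supp w).map (gen F)).prod
      = - (((supp w).map (gen F)).prod * gen F n) := by
    rw [gen, ι_mul, h2]; simp [gen]
  rw [smul_mul_assoc, mul_smul_comm, h3, smul_neg, ← neg_smul, ← sub_eq_zero, ← sub_smul] at h1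
  have h4 : ((supp w).map (gen F)).prod * gen F n ≠ 0 := by
    have := prod_ne (F := F) _ (supp_nodup w)
    simpa using this
  have h5 := (smul_eq_zero.1 h1).resolve_right h4
  have : (2 : F) * c w = 0 := by linear_combination h5
  simpa using this

lemma card_eq [CharZero F] (hn : 1 ≤ n) :
    Nat.card {w : Fin n → Bool // sg F w = 1} = 2 ^ (n - 1) ∧
    Nat.card {w : Fin n → Bool // sg F w ≠ 1} = 2 ^ (n - 1) := by
  classical
  have hs : ∑ w : Fin n → Bool, sg F w = 0 := by
    have := Fintype.prod_sum (fun (_ : Fin n) (b : Bool) => if b then (-1 : F) else 1)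
    unfold sg
    rw [← this]
    simp; omega
  rw [← Finset.sum_filter_add_sum_filter_not _ (fun w => sg F w = 1),
    Finset.sum_congr rfl (g := fun _ => (1 : F)) (by simp),
    Finset.sum_congr (s₁ := Finset.filter (fun w => ¬ sg F w = 1) _) rfl (g := fun _ => (-1 : F))
      (fun w hw => (sg_cases w).resolve_left (Finset.mem_filter.1 hw).2)] at hs
  have ht := Finset.card_filter_add_card_filter_not (s := (Finset.univ : Finset (Fin n → Bool)))
    (fun w => sg F w = 1)
  simp only [Finset.sum_const, nsmul_eq_mul, mul_one, mul_neg, ← sub_eq_add_neg, sub_eq_zero,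
    Nat.cast_inj] at hs
  rw [Nat.card_eq_fintype_card, Nat.card_eq_fintype_card, Fintype.card_subtype,
    Fintype.card_subtype]
  simp only [Finset.card_univ, Fintype.card_fun, Fintype.card_bool, Fintype.card_fin] at ht
  obtain ⟨m, rfl⟩ : ∃ m, n = m + 1 := ⟨n - 1, by omega⟩
  rw [pow_succ] at ht
  simp only [Nat.add_sub_cancel, ne_eq]
  omega

lemma finrank_aux {V : Type} [AddCommGroup V] [Module F V] (N : Submodule F V)
    {κ : Type} [Fintype κ] (b : κ → V)
    (hs : ∀ v, ∃ c : κ → F, v - ∑ i, c i • b i ∈ N)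
    (hi : ∀ c : κ → F, ∑ i, c i • b i ∈ N → c = 0) :
    Module.finrank F (V ⧸ N) = Nat.card κ := by
  have hb : Function.Bijective (N.mkQ ∘ₗ Fintype.linearCombination F b) := by
    constructor
    · rw [← LinearMap.ker_eq_bot, LinearMap.ker_eq_bot']
      intro c hc
      apply hi
      rw [LinearMap.comp_apply, Fintype.linearCombination_apply] at hc
      exact (Submodule.Quotient.mk_eq_zero N).1 hc
    · intro q
      obtain ⟨v, rfl⟩ := N.mkQ_surjective q
      obtain ⟨c, hc⟩ := hs v
      refine ⟨c, ?_⟩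
      rw [LinearMap.comp_apply, Fintype.linearCombination_apply, eq_comm, ← sub_eq_zero,
        ← map_sub]
      exact (Submodule.Quotient.mk_eq_zero N).2 hc
  rw [← (LinearEquiv.ofBijective _ hb).finrank_eq, Module.finrank_fintype_fun_eq_card,
    Nat.card_eq_fintype_card]

lemma extend_sum (q : (Fin n → Bool) → Prop) [DecidablePred q] (c : {w // q w} → F) :
    ∑ w : {w // q w}, c w • mw F w.1
      = ∑ w, (if h : q w then c ⟨w, h⟩ else 0) • mw F w := by
  rw [← Fintype.sum_subtype_add_sum_subtype q]
  rw [Finset.sum_congr (s₁ := (Finset.univ : Finset {x // ¬ q x})) rfl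
    (g := fun _ => (0 : FA F)) (fun w _ => by simp [w.2]), Finset.sum_const_zero, add_zero]
  exact Finset.sum_congr rfl fun w _ => by simp [w.2]

lemma part1 [CharZero F] (hn : 1 ≤ n) : scodim F (P F n) (C F) = 2 ^ (n - 1) := by
  classical
  rw [← (card_eq (F := F) hn).2, scodim]
  refine finrank_aux _ (fun w => (⟨mw F w.1, mw_mem w.1⟩ : P F n)) ?_ ?_
  · rintro ⟨p, hp⟩
    obtain ⟨c, hc⟩ := claimA p hp
    refine ⟨fun w => c w.1, ?_⟩
    have h1 : p - ∑ w, c w • mw F w ∈ C F := PI_le_C hn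
      ⟨Submodule.sub_mem _ hp (Submodule.sum_mem _ fun w _ => Submodule.smul_mem _ _ (mw_mem w)), hc⟩
    have h2 : ∑ w : {w : Fin n → Bool // sg F w = 1}, c w.1 • mw F w.1 ∈ C F :=
      Submodule.sum_mem _ fun w _ => Submodule.smul_mem _ _ (claimD hn w.1 w.2)
    have h3 := (C F).add_mem h1 h2
    rw [← Fintype.sum_subtype_add_sum_subtype (fun w => sg F w = 1)] at h3
    rw [Submodule.mem_comap]
    simp only [map_sub, map_sum, map_smul, Submodule.subtype_apply]
    convert h3 using 1
    abel
  · intro c hc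
    rw [Submodule.mem_comap] at hc
    simp only [map_sum, map_smul, Submodule.subtype_apply] at hc
    rw [extend_sum (fun w => sg F w ≠ 1)] at hc
    funext w
    have := claimB _ hc w.1 w.2
    rw [dif_pos w.2] at this
    exact this

lemma part2 [CharZero F] (hn : 1 ≤ n) : deltaDim F (P F n) (C F) (I F) = 2 ^ (n - 1) := by
  classical
  rw [← (card_eq (F := F) hn).1, deltaDim]
  refine finrank_aux _
    (fun w => (⟨mw F w.1, mw_mem w.1, claimD hn w.1 w.2⟩ : ↥(P F n ⊓ C F))) ?_ ?_
  · rintro ⟨p, hp, hpC⟩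
    obtain ⟨c, hc⟩ := claimA p hp
    refine ⟨fun w => c w.1, ?_⟩
    have hm : p - ∑ w, c w • mw F w ∈ P F n :=
      Submodule.sub_mem _ hp (Submodule.sum_mem _ fun w _ => Submodule.smul_mem _ _ (mw_mem w))
    have h1 : p - ∑ w, c w • mw F w ∈ C F := PI_le_C hn ⟨hm, hc⟩
    have h2 : ∑ w, c w • mw F w ∈ C F := by
      have := (C F).sub_mem hpC h1
      rwa [sub_sub_cancel] at this
    have h3 : ∑ w : {w : Fin n → Bool // ¬ sg F w = 1}, c w.1 • mw F w.1 = 0 :=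
      Finset.sum_eq_zero fun w _ => by rw [claimB c h2 w.1 w.2, zero_smul]
    have h4 : p - ∑ w, c w • mw F w ∈ P F n ⊓ I F := ⟨hm, hc⟩
    rw [← Fintype.sum_subtype_add_sum_subtype (fun w => sg F w = 1), h3, add_zero] at h4
    rw [Submodule.mem_comap]
    simpa only [map_sub, map_sum, map_smul, Submodule.subtype_apply] using h4
  · intro c hc
    rw [Submodule.mem_comap] at hc
    simp only [map_sum, map_smul, Submodule.subtype_apply] at hc
    rw [extend_sum (fun w => sg F w = 1)] at hc
    funext w
    have := congrFun (claimC _ hc.2) w.1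
    simp only [dif_pos w.2] at this
    exact this

end

end Stmt17

/-- for `n ≥ 1`, the infinite-dimensional Grassmann algebra with
its canonical grading satisfies `c_n^{gr,z}(G^{gr}) = δ_n^{gr}(G^{gr}) = 2^{n-1}`. -/
theorem stmt17 (F : Type) [Field F] [CharZero F] (n : ℕ) (hn : 1 ≤ n) :
    scodim F (PnGr F n)
        (CGr F (ExteriorAlgebra F (ℕ →₀ F))
          (grEven F (ℕ →₀ F)) (grOdd F (ℕ →₀ F))) = 2 ^ (n - 1) ∧
    deltaDim F (PnGr F n)
        (CGr F (ExteriorAlgebra F (ℕ →₀ F))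
          (grEven F (ℕ →₀ F)) (grOdd F (ℕ →₀ F)))
        (IdGr F (ExteriorAlgebra F (ℕ →₀ F))
          (grEven F (ℕ →₀ F)) (grOdd F (ℕ →₀ F))) = 2 ^ (n - 1) := by
  exact ⟨Stmt17.part1 hn, Stmt17.part2 hn⟩
end
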